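/- arXiv:2601.15692 — 2 statements merged into one kernel-verified Lean document; each statement's English description precedes it below -/
import Mathlib

section
/- Let K be a field and a, b, c pairwise coprime positive integers. The symbolic Rees algebra R_s(𝔭_K(a,b,c)) is Noetherian if and only if Huneke's condition is satisfied, i.e., if and only if there exists an S-regular sequence g1, g2 of homogeneous elements with g1 ∈ [𝔭_K(a,b,c)^{(r1)}]_{d1} and g2 ∈ [𝔭_K(a,b,c)^{(r2)}]_{d2} for some positive integers d1, d2, r1, r2 such that (d1/r1)·(d2/r2) = abc (equivalently d1·d2 = abc·r1·r2). -/
open MvPolynomial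

noncomputable section

/-- The weight function assigning degrees `a, b, c` to the variables `x, y, z`. -/
def wt (a b c : ℕ) : Fin 3 → ℕ := ![a, b, c]

/-- The `K`-algebra map `K[x,y,z] → K[T]`, `x ↦ T^a`, `y ↦ T^b`, `z ↦ T^c`. -/
def toPoly (K : Type*) [CommRing K] (a b c : ℕ) :
    MvPolynomial (Fin 3) K →ₐ[K] Polynomial K :=
  aeval ![Polynomial.X ^ a, Polynomial.X ^ b, Polynomial.X ^ c]

/-- The space monomial prime `𝔭_K(a,b,c)`. -/
def pIdeal (K : Type*) [CommRing K] (a b c : ℕ) : Ideal (MvPolynomial (Fin 3) K) :=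
  RingHom.ker (toPoly K a b c)

instance pIdeal_isPrime (K : Type*) [Field K] (a b c : ℕ) : (pIdeal K a b c).IsPrime :=
  RingHom.ker_isPrime _

/-- The `n`-th symbolic power `Q^{(n)} = Q^n A_Q ∩ A` of a prime ideal. -/
def symbPow {A : Type*} [CommRing A] (Q : Ideal A) [Q.IsPrime] (n : ℕ) : Ideal A :=
  Ideal.comap (algebraMap A (Localization.AtPrime Q))
    (Ideal.map (algebraMap A (Localization.AtPrime Q)) (Q ^ n))

/-- The symbolic Rees algebra `A[Qt, Q^{(2)}t^2, …] ⊆ A[t]`. -/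
def symbolicRees {A : Type*} [CommRing A] (Q : Ideal A) [Q.IsPrime] :
    Subalgebra A (Polynomial A) :=
  Algebra.adjoin A
    (⋃ n : ℕ, (fun p => Polynomial.C p * Polynomial.X ^ n) '' ((symbPow Q n : Ideal A) : Set A))

/-- The degree-`d` homogeneous component `[J]_d` of an ideal `J ⊆ K[x,y,z]`,
as a `K`-subspace. -/
def gpiece (K : Type*) [CommRing K] (a b c : ℕ) (J : Ideal (MvPolynomial (Fin 3) K))
    (d : ℕ) : Submodule K (MvPolynomial (Fin 3) K) :=
  (Submodule.restrictScalars K J) ⊓ (weightedHomogeneousSubmodule K (wt a b c) d)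

end

section Taylor

variable (K : Type*) [Field K] (a b c p q : ℕ)

/-- The expansion of polynomials along the monomial curve, in coordinates transversal to it. -/
noncomputable def taylor : MvPolynomial (Fin 3) K →ₐ[K] MvPolynomial (Fin 2) (Polynomial K) :=
  aeval ![C (Polynomial.X ^ a) * (1 + X 0) ^ q, C (Polynomial.X ^ b) * (1 + X 0) ^ p,
    C (Polynomial.X ^ c) * (1 + X 1)]

/-- The order of vanishing along the monomial curve. -/
noncomputable def curveOrder (f : MvPolynomial (Fin 3) K) : ℕ∞ :=
  ((taylor K a b c p q f : MvPolynomial (Fin 2) (Polynomial K)) :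
    MvPowerSeries (Fin 2) (Polynomial K)).order

lemma constantCoeff_taylor (f : MvPolynomial (Fin 3) K) :
    constantCoeff (taylor K a b c p q f) = toPoly K a b c f := by
  have : ((aeval (0 : Fin 2 → Polynomial K)).restrictScalars K).comp
      (taylor K a b c p q) = toPoly K a b c := by
    apply MvPolynomial.algHom_ext
    intro i
    fin_cases i <;> simp [taylor, toPoly]
  have := DFunLike.congr_fun this f
  simpa using this

lemma le_curveOrder_iff (n : ℕ) (f : MvPolynomial (Fin 3) K) :
    (n : ℕ∞) ≤ curveOrder K a b c p q f ↔
      ∀ x : Fin 2 →₀ ℕ, x.degree < n → coeff x (taylor K a b c p q f) = 0 := by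
  constructor
  · intro h x hx
    have := MvPowerSeries.coeff_of_lt_order (lt_of_lt_of_le (Nat.cast_lt.mpr hx) h)
    simpa using this
  · intro h
    exact MvPowerSeries.nat_le_order fun d hd => by simpa using h d hd

lemma curveOrder_mul (f g : MvPolynomial (Fin 3) K) :
    curveOrder K a b c p q (f * g) = curveOrder K a b c p q f + curveOrder K a b c p q g := by
  simp [curveOrder, MvPowerSeries.order_mul]

lemma mem_pIdeal_iff (f : MvPolynomial (Fin 3) K) :
    f ∈ pIdeal K a b c ↔ constantCoeff (taylor K a b c p q f) = 0 := by
  rw [constantCoeff_taylor]; rfl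

lemma curveOrder_eq_zero_iff (f : MvPolynomial (Fin 3) K) :
    curveOrder K a b c p q f = 0 ↔ f ∉ pIdeal K a b c := by
  rw [mem_pIdeal_iff K a b c p q, ← Order.lt_one_iff, ← not_le, not_iff_not]
  have := le_curveOrder_iff K a b c p q 1 f
  rw [Nat.cast_one] at this
  rw [this]
  constructor
  · intro h
    exact h 0 (by simp)
  · intro h x hx
    have : x = 0 := by
      rw [Nat.lt_one_iff] at hx
      exact (Finsupp.degree_eq_zero_iff x).mp hx
    rw [this]; exact h

lemma curveOrder_X (i : Fin 3) : curveOrder K a b c p q (X i) = 0 := by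
  rw [curveOrder_eq_zero_iff]
  change ¬ (toPoly K a b c (X i) = 0)
  fin_cases i <;> simp [toPoly]

lemma le_curveOrder_iff_mem_pow (n : ℕ) (f : MvPolynomial (Fin 3) K) :
    (n : ℕ∞) ≤ curveOrder K a b c p q f ↔
      taylor K a b c p q f ∈ idealOfVars (Fin 2) (Polynomial K) ^ n := by
  rw [le_curveOrder_iff, mem_pow_idealOfVars_iff']

lemma pIdeal_le_comap :
    pIdeal K a b c ≤ (idealOfVars (Fin 2) (Polynomial K)).comap (taylor K a b c p q) := by
  intro f hf
  have h : (1 : ℕ∞) ≤ curveOrder K a b c p q f := by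
    rw [Order.one_le_iff_ne_zero, Ne, curveOrder_eq_zero_iff, not_not]
    exact hf
  have := (le_curveOrder_iff_mem_pow K a b c p q 1 f).mp (by simpa using h)
  simpa using this

lemma le_curveOrder_of_mem_symbPow {n : ℕ} {f : MvPolynomial (Fin 3) K}
    (hf : f ∈ symbPow (pIdeal K a b c) n) : (n : ℕ∞) ≤ curveOrder K a b c p q f := by
  rw [symbPow, Ideal.mem_comap,
    IsLocalization.algebraMap_mem_map_algebraMap_iff (pIdeal K a b c).primeCompl] at hf
  obtain ⟨s, hs, hsf⟩ := hf
  have h1 : taylor K a b c p q (s * f) ∈ idealOfVars (Fin 2) (Polynomial K) ^ n := by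
    have := Ideal.pow_right_mono (pIdeal_le_comap K a b c p q) n hsf
    exact Ideal.le_comap_pow _ n this
  rw [← le_curveOrder_iff_mem_pow, curveOrder_mul,
    (curveOrder_eq_zero_iff K a b c p q s).mpr hs, zero_add] at h1
  exact h1

/-- A rational inverse of `taylor`, regular at the generic point of the curve. -/
lemma exists_taylor_inverse (hpq : p * a = q * b + 1) :
    ∃ η : MvPolynomial (Fin 2) (Polynomial K) →+* Localization.AtPrime (pIdeal K a b c),
      (∀ f, η (taylor K a b c p q f) = algebraMap _ _ f) ∧
      ∀ i, η (X i) ∈ (pIdeal K a b c).map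
        (algebraMap _ (Localization.AtPrime (pIdeal K a b c))) := by
  set A := Localization.AtPrime (pIdeal K a b c)
  let φ := algebraMap (MvPolynomial (Fin 3) K) A
  have hX : ∀ i : Fin 3, IsUnit (φ (X i)) := fun i =>
    IsLocalization.map_units A (⟨X i, fun h => by
      change toPoly K a b c (X i) = 0 at h
      fin_cases i <;> simp [toPoly] at h⟩ : (pIdeal K a b c).primeCompl)
  obtain ⟨x, hx⟩ := hX 0
  obtain ⟨y, hy⟩ := hX 1
  let T : Aˣ := x ^ p * (y ^ q)⁻¹
  let u : Aˣ := y ^ a * (x ^ b)⁻¹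
  have e1 : T ^ a * u ^ q = x := by
    have : x ^ (p * a) = x ^ (q * b + 1) := by rw [hpq]
    simp only [T, u, mul_pow, inv_pow, ← pow_mul]
    rw [this, pow_succ, mul_comm b q, mul_comm a q]
    group
  have e2 : T ^ b * u ^ p = y := by
    have : y ^ (a * p) = y ^ (q * b + 1) := by rw [mul_comm, hpq]
    simp only [T, u, mul_pow, inv_pow, ← pow_mul]
    rw [this, pow_succ, mul_comm b p]
    group
    rw [zpow_neg, mul_right_comm, mul_inv_cancel, one_mul]
  let v : A := φ (X 2) * ((T ^ c)⁻¹ : Aˣ)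
  let η : MvPolynomial (Fin 2) (Polynomial K) →ₐ[K] A :=
    aevalTower (Polynomial.aeval (T : A)) ![(u : A) - 1, v - 1]
  refine ⟨η, ?_, ?_⟩
  · have : η.comp (taylor K a b c p q) = IsScalarTower.toAlgHom K _ A := by
      apply MvPolynomial.algHom_ext
      intro i
      fin_cases i
      · have := congrArg Units.val e1
        rw [Units.val_mul, Units.val_pow_eq_pow_val, Units.val_pow_eq_pow_val, hx] at this
        simpa [taylor, η] using this
      · have := congrArg Units.val e2
        rw [Units.val_mul, Units.val_pow_eq_pow_val, Units.val_pow_eq_pow_val, hy] at this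
        simpa [taylor, η] using this
      · have : (T : A) ^ c * v = φ (X 2) := by
          simp only [v]
          rw [mul_left_comm, ← Units.val_pow_eq_pow_val, Units.mul_inv, mul_one]
        simpa [taylor, η] using this
    exact fun f => DFunLike.congr_fun this f
  · have key : ∀ f g : MvPolynomial (Fin 3) K, ∀ s t : A, IsUnit s → IsUnit t →
        toPoly K a b c f = toPoly K a b c g → ∀ w : A, s * (w - 1) = t * (φ f - φ g) →
        w - 1 ∈ (pIdeal K a b c).map φ := by
      intro f g s t hs ht hfg w hw
      have h1 : φ f - φ g ∈ (pIdeal K a b c).map φ := by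
        rw [← map_sub]
        refine Ideal.mem_map_of_mem _ ?_
        change toPoly K a b c (f - g) = 0
        rw [map_sub, hfg, sub_self]
      rw [← Ideal.unit_mul_mem_iff_mem _ hs, hw]
      exact Ideal.mul_mem_left _ _ h1
    intro i
    fin_cases i
    · have h1 : (x : A) ^ b * ((u : A) - 1) = 1 * (φ (X 1 ^ a) - φ (X 0 ^ b)) := by
        have : x ^ b * u = y ^ a := by
          simp only [u]
          rw [mul_left_comm, mul_inv_cancel, mul_one]
        have := congrArg Units.val this
        simp only [Units.val_mul, Units.val_pow_eq_pow_val] at this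
        rw [map_pow, map_pow, ← hx, ← hy, mul_sub, this]
        ring
      simpa [η] using key _ _ _ _ (x.isUnit.pow b) isUnit_one
        (by simp [toPoly, ← pow_mul, mul_comm]) _ h1
    · have h1 : (x : A) ^ (p * c) * (v - 1) =
          1 * (φ (X 2 * X 1 ^ (q * c)) - φ (X 0 ^ (p * c))) := by
        have : x ^ (p * c) * (T ^ c)⁻¹ = y ^ (q * c) := by
          simp only [T, mul_pow, inv_pow, ← pow_mul]
          rw [mul_inv, inv_inv, ← mul_assoc, mul_inv_cancel, one_mul]
        have := congrArg Units.val this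
        simp only [Units.val_mul, Units.val_pow_eq_pow_val] at this
        rw [map_mul, map_pow, map_pow, ← hx, ← hy, mul_sub, ← this]
        simp only [v]
        ring
      simpa [η] using key _ _ _ _ (x.isUnit.pow (p * c)) isUnit_one
        (by simp only [toPoly, map_mul, map_pow, aeval_X]
            simp only [Matrix.cons_val, ← pow_mul, ← pow_add]
            congr 1
            calc c + b * (q * c) = c * (q * b + 1) := by ring
              _ = a * (p * c) := by rw [← hpq]; ring) _ h1

lemma mem_symbPow_iff (hpq : p * a = q * b + 1) {n : ℕ} {f : MvPolynomial (Fin 3) K} :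
    f ∈ symbPow (pIdeal K a b c) n ↔ (n : ℕ∞) ≤ curveOrder K a b c p q f := by
  refine ⟨le_curveOrder_of_mem_symbPow K a b c p q, fun h => ?_⟩
  obtain ⟨η, h1, h2⟩ := exists_taylor_inverse K a b c p q hpq
  rw [le_curveOrder_iff_mem_pow] at h
  have h3 : idealOfVars (Fin 2) (Polynomial K) ≤ ((pIdeal K a b c).map
        (algebraMap _ (Localization.AtPrime (pIdeal K a b c)))).comap η := by
    rw [idealOfVars, Ideal.span_le]
    rintro _ ⟨i, rfl⟩
    exact h2 i
  rw [symbPow, Ideal.mem_comap, Ideal.map_pow, ← h1]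
  exact Ideal.le_comap_pow _ n (Ideal.pow_right_mono h3 n h)

end Taylor

section Grading

variable (K : Type*) [Field K] (a b c : ℕ)

/-- The weights of the variables, as integers. -/
def intWt (i : Fin 3) : ℤ := (wt a b c i : ℤ)

lemma weight_intWt (m : Fin 3 →₀ ℕ) :
    Finsupp.weight (intWt a b c) m = ((Finsupp.weight (wt a b c) m : ℕ) : ℤ) := by
  simp [Finsupp.weight_apply, Finsupp.sum, intWt]

variable {K a b c}

lemma isWeightedHomogeneous_intWt {f : MvPolynomial (Fin 3) K} {d : ℕ} :
    IsWeightedHomogeneous (intWt a b c) f (d : ℤ) ↔ IsWeightedHomogeneous (wt a b c) f d := by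
  simp only [IsWeightedHomogeneous, weight_intWt, Nat.cast_inj]

lemma eq_zero_of_isWeightedHomogeneous_neg {f : MvPolynomial (Fin 3) K} {d : ℤ}
    (hf : IsWeightedHomogeneous (intWt a b c) f d) (hd : d < 0) : f = 0 := by
  ext m
  refine hf.coeff_eq_zero m ?_
  rw [weight_intWt]
  lia

lemma weightedHomogeneousComponent_mul {g : MvPolynomial (Fin 3) K} {d : ℤ}
    (hg : IsWeightedHomogeneous (intWt a b c) g d) (e : ℤ) (f : MvPolynomial (Fin 3) K) :
    weightedHomogeneousComponent (intWt a b c) e (g * f) =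
      g * weightedHomogeneousComponent (intWt a b c) (e - d) f := by
  classical
  induction f using MvPolynomial.induction_on' with
  | add f₁ f₂ h₁ h₂ => rw [mul_add, map_add, h₁, h₂, map_add, mul_add]
  | monomial m r =>
    have h := isWeightedHomogeneous_monomial (intWt a b c) m r rfl
    rw [weightedHomogeneousComponent_of_mem (hg.mul h), weightedHomogeneousComponent_of_mem h]
    by_cases h' : e = d + Finsupp.weight (intWt a b c) m
    · rw [if_pos h', if_pos (by lia)]
    · rw [if_neg h', if_neg (by lia), mul_zero]

lemma taylor_monomial (p q : ℕ) (m : Fin 3 →₀ ℕ) :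
    ∃ B : MvPolynomial (Fin 2) K, ∀ r : K, taylor K a b c p q (monomial m r) =
      C (Polynomial.monomial (Finsupp.weight (wt a b c) m) r) * map Polynomial.C B := by
  refine ⟨((1 + X 0) ^ q) ^ m 0 * ((1 + X 0) ^ p) ^ m 1 * (1 + X 1) ^ m 2, fun r => ?_⟩
  have : C (Polynomial.monomial (Finsupp.weight (wt a b c) m) r) =
      algebraMap K _ r * C (σ := Fin 2) ((Polynomial.X ^ a) ^ m 0 * (Polynomial.X ^ b) ^ m 1 *
        (Polynomial.X ^ c) ^ m 2) := by
    rw [← Polynomial.C_mul_X_pow_eq_monomial, C_mul, Finsupp.weight_apply,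
      Finsupp.sum_fintype _ _ (by simp), Fin.sum_univ_three]
    simp [wt, MvPolynomial.algebraMap_eq, ← pow_mul, ← pow_add, mul_comm,
      IsScalarTower.algebraMap_apply K (Polynomial K) (MvPolynomial (Fin 2) (Polynomial K))]
  rw [taylor, aeval_monomial, this, Finsupp.prod_fintype _ _ (by simp), Fin.prod_univ_three]
  simp only [Matrix.cons_val, map_mul, map_pow, map_add, map_one, map_X, mul_pow]
  ring

/-- The coefficients of the Taylor expansion along the curve, as linear forms. -/
noncomputable def taylorCoeff (a b c p q : ℕ) (x : Fin 2 →₀ ℕ) (e : ℕ) :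
    MvPolynomial (Fin 3) K →ₗ[K] K :=
  Polynomial.lcoeff K e ∘ₗ
    ((lcoeff (Polynomial K) x).restrictScalars K) ∘ₗ (taylor K a b c p q).toLinearMap

lemma taylorCoeff_apply (p q : ℕ) (x : Fin 2 →₀ ℕ) (e : ℕ) (f : MvPolynomial (Fin 3) K) :
    taylorCoeff a b c p q x e f = (coeff x (taylor K a b c p q f)).coeff e := rfl

lemma taylorCoeff_weightedHomogeneousComponent (p q : ℕ) (x : Fin 2 →₀ ℕ) (e : ℕ)
    (f : MvPolynomial (Fin 3) K) :
    taylorCoeff a b c p q x e (weightedHomogeneousComponent (intWt a b c) e f) =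
      taylorCoeff a b c p q x e f := by
  classical
  induction f using MvPolynomial.induction_on' with
  | add f₁ f₂ h₁ h₂ => rw [map_add, map_add, h₁, h₂, map_add]
  | monomial m r =>
    have h := isWeightedHomogeneous_monomial (intWt a b c) m r rfl
    rw [weightedHomogeneousComponent_of_mem h]
    split_ifs with h'
    · rfl
    · obtain ⟨B, hB⟩ := taylor_monomial (K := K) (a := a) (b := b) (c := c) p q m
      rw [map_zero, taylorCoeff_apply, hB, coeff_C_mul, coeff_map, Polynomial.coeff_mul_C,
        Polynomial.coeff_monomial, if_neg, zero_mul]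
      rintro h''
      apply h'
      rw [weight_intWt, h'']

lemma taylorCoeff_eq_zero (p q : ℕ) (x : Fin 2 →₀ ℕ) {e : ℕ} {d : ℤ} (h : (e : ℤ) ≠ d)
    {f : MvPolynomial (Fin 3) K} (hf : IsWeightedHomogeneous (intWt a b c) f d) :
    taylorCoeff a b c p q x e f = 0 := by
  rw [← taylorCoeff_weightedHomogeneousComponent, hf.weightedHomogeneousComponent_ne _ h,
    map_zero]

lemma le_curveOrder_iff_taylorCoeff (p q n : ℕ) (f : MvPolynomial (Fin 3) K) :
    (n : ℕ∞) ≤ curveOrder K a b c p q f ↔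
      ∀ x : Fin 2 →₀ ℕ, x.degree < n → ∀ e, taylorCoeff a b c p q x e f = 0 := by
  rw [le_curveOrder_iff]
  refine forall₂_congr fun x _ => ?_
  rw [Polynomial.ext_iff]
  rfl

end Grading

lemma exists_mul_eq_mul_add_one {a b : ℕ} (ha : 0 < a) (hb : 0 < b) (hab : a.Coprime b) :
    ∃ p q : ℕ, p * a = q * b + 1 := by
  obtain rfl | h1 := eq_or_ne b 1
  · exact ⟨1, a - 1, by lia⟩
  · obtain ⟨m, -, hm⟩ := Nat.exists_mul_mod_eq_one_of_coprime hab (by lia)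
    exact ⟨m, a * m / b, by rw [mul_comm m, ← hm, Nat.div_add_mod']⟩

section SymbolicPowers

variable {K : Type*} [Field K] {a b c : ℕ}

lemma symbPow_zero : symbPow (pIdeal K a b c) 0 = ⊤ := by
  simp [symbPow, Ideal.one_eq_top, Ideal.map_top]

lemma symbPow_anti {m n : ℕ} (h : m ≤ n) :
    symbPow (pIdeal K a b c) n ≤ symbPow (pIdeal K a b c) m :=
  Ideal.comap_mono (Ideal.map_mono (Ideal.pow_le_pow_right h))

lemma mul_mem_symbPow {m n : ℕ} {f g : MvPolynomial (Fin 3) K}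
    (hf : f ∈ symbPow (pIdeal K a b c) m) (hg : g ∈ symbPow (pIdeal K a b c) n) :
    f * g ∈ symbPow (pIdeal K a b c) (m + n) := by
  rw [symbPow, Ideal.mem_comap] at *
  rw [map_mul, pow_add, Ideal.map_mul]
  exact Ideal.mul_mem_mul hf hg

variable (a b c) in
/-- `g` vanishes to order exactly `o` along the curve. -/
def HasOrder (g : MvPolynomial (Fin 3) K) (o : ℕ) : Prop :=
  g ∈ symbPow (pIdeal K a b c) o ∧ g ∉ symbPow (pIdeal K a b c) (o + 1)

lemma hasOrder_iff {p q : ℕ} (hpq : p * a = q * b + 1) {g : MvPolynomial (Fin 3) K} {o : ℕ} :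
    HasOrder a b c g o ↔ curveOrder K a b c p q g = o := by
  rw [HasOrder, mem_symbPow_iff K a b c p q hpq, mem_symbPow_iff K a b c p q hpq, not_le,
    Nat.cast_add, Nat.cast_one, ENat.lt_add_one_iff (by simp)]
  exact ⟨fun h => le_antisymm h.2 h.1, fun h => ⟨h.ge, h.le⟩⟩

lemma HasOrder.le_of_mem {g : MvPolynomial (Fin 3) K} {o n : ℕ} (hg : HasOrder a b c g o)
    (h : g ∈ symbPow (pIdeal K a b c) n) : n ≤ o := by
  by_contra! h'
  exact hg.2 (symbPow_anti h' h)

variable (ha : 0 < a) (hb : 0 < b) (hab : a.Coprime b)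
include ha hb hab

lemma symbPow_le_pIdeal {n : ℕ} (hn : 0 < n) :
    symbPow (pIdeal K a b c) n ≤ pIdeal K a b c := by
  obtain ⟨p, q, hpq⟩ := exists_mul_eq_mul_add_one ha hb hab
  intro f hf
  by_contra h
  rw [mem_symbPow_iff K a b c p q hpq, (curveOrder_eq_zero_iff K a b c p q f).mpr h] at hf
  simp at hf
  lia

lemma HasOrder.mul_mem_iff {g f : MvPolynomial (Fin 3) K} {o n : ℕ} (hg : HasOrder a b c g o) :
    g * f ∈ symbPow (pIdeal K a b c) n ↔ f ∈ symbPow (pIdeal K a b c) (n - o) := by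
  obtain ⟨p, q, hpq⟩ := exists_mul_eq_mul_add_one ha hb hab
  rw [mem_symbPow_iff K a b c p q hpq, mem_symbPow_iff K a b c p q hpq, curveOrder_mul,
    (hasOrder_iff hpq).mp hg, ENat.natCast_sub, tsub_le_iff_left]

lemma HasOrder.mul {f g : MvPolynomial (Fin 3) K} {m n : ℕ} (hf : HasOrder a b c f m)
    (hg : HasOrder a b c g n) : HasOrder a b c (f * g) (m + n) := by
  obtain ⟨p, q, hpq⟩ := exists_mul_eq_mul_add_one ha hb hab
  rw [hasOrder_iff hpq] at *
  rw [curveOrder_mul, hf, hg, Nat.cast_add]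

lemma exists_hasOrder {g : MvPolynomial (Fin 3) K} (hg : g ≠ 0) : ∃ o, HasOrder a b c g o := by
  obtain ⟨p, q, hpq⟩ := exists_mul_eq_mul_add_one ha hb hab
  simp_rw [hasOrder_iff hpq]
  have : curveOrder K a b c p q g ≠ ⊤ := by
    rw [curveOrder, Ne, MvPowerSeries.order_eq_top_iff, MvPolynomial.coe_eq_zero_iff]
    intro h
    obtain ⟨η, h1, -⟩ := exists_taylor_inverse K a b c p q hpq
    have := h1 g
    rw [h, map_zero] at this
    exact hg ((FaithfulSMul.algebraMap_eq_zero_iff _ _).mp this.symm)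
  exact ⟨_, (ENat.natCast_toNat this).symm⟩

lemma hasOrder_X (i : Fin 3) : HasOrder a b c (X i : MvPolynomial (Fin 3) K) 0 := by
  obtain ⟨p, q, hpq⟩ := exists_mul_eq_mul_add_one ha hb hab
  rw [hasOrder_iff hpq, curveOrder_X]
  rfl

lemma weightedHomogeneousComponent_mem_symbPow {f : MvPolynomial (Fin 3) K} {n : ℕ}
    (hf : f ∈ symbPow (pIdeal K a b c) n) (d : ℤ) :
    weightedHomogeneousComponent (intWt a b c) d f ∈ symbPow (pIdeal K a b c) n := by
  obtain ⟨p, q, hpq⟩ := exists_mul_eq_mul_add_one ha hb hab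
  rw [mem_symbPow_iff K a b c p q hpq, le_curveOrder_iff_taylorCoeff] at *
  intro x hx e
  by_cases h : (e : ℤ) = d
  · subst h
    rw [taylorCoeff_weightedHomogeneousComponent, hf x hx e]
  · exact taylorCoeff_eq_zero _ _ _ h (weightedHomogeneousComponent_isWeightedHomogeneous d f)

end SymbolicPowers

lemma exists_mul_add_mul_eq {a b m : ℕ} (ha : 0 < a) (hb : 0 < b) (hab : a.Coprime b)
    (hm : a * b ≤ m) : ∃ s t : ℕ, a * s + b * t = m := by
  obtain ⟨p, q, hpq⟩ := exists_mul_eq_mul_add_one ha hb hab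
  have h1 : a * (m * p % b) ≤ m :=
    (Nat.mul_le_mul_left a (Nat.mod_lt _ hb).le).trans hm
  have h2 : a * (m * p % b) ≡ m [MOD b] := by
    calc a * (m * p % b) ≡ a * (m * p) [MOD b] := (Nat.mod_modEq _ _).mul_left a
      _ = m + b * (m * q) := by linear_combination m * hpq
      _ ≡ m [MOD b] := by simp [Nat.ModEq]
  obtain ⟨t, ht⟩ := (Nat.modEq_iff_dvd' h1).mp h2
  exact ⟨m * p % b, t, by lia⟩

section Dimension

variable (K : Type*) [Field K] (a b c : ℕ)

/-- The homogeneous component of degree `d` of the symbolic power `𝔭^{(n)}`. -/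
noncomputable def symbPiece (n : ℕ) (d : ℤ) : Submodule K (MvPolynomial (Fin 3) K) :=
  (symbPow (pIdeal K a b c) n).restrictScalars K ⊓ weightedHomogeneousSubmodule K (intWt a b c) d

/-- The dimension of `symbPiece`. -/
noncomputable def symbDim (n : ℕ) (d : ℤ) : ℤ := Module.finrank K (symbPiece K a b c n d)

variable {K a b c}

lemma mem_symbPiece {n : ℕ} {d : ℤ} {f : MvPolynomial (Fin 3) K} :
    f ∈ symbPiece K a b c n d ↔
      f ∈ symbPow (pIdeal K a b c) n ∧ IsWeightedHomogeneous (intWt a b c) f d := Iff.rfl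

lemma mem_symbPiece_zero {d : ℤ} {f : MvPolynomial (Fin 3) K} :
    f ∈ symbPiece K a b c 0 d ↔ IsWeightedHomogeneous (intWt a b c) f d := by
  simp [mem_symbPiece, symbPow_zero]

lemma symbPiece_anti {m n : ℕ} (h : m ≤ n) (d : ℤ) :
    symbPiece K a b c n d ≤ symbPiece K a b c m d :=
  fun _ hf => ⟨symbPow_anti h hf.1, hf.2⟩

lemma symbPiece_neg {n : ℕ} {d : ℤ} (hd : d < 0) : symbPiece K a b c n d = ⊥ := by
  rw [eq_bot_iff]
  exact fun f hf => eq_zero_of_isWeightedHomogeneous_neg hf.2 hd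

lemma symbDim_neg {n : ℕ} {d : ℤ} (hd : d < 0) : symbDim K a b c n d = 0 := by
  rw [symbDim, symbPiece_neg hd]
  simp

/-- The exponent vectors of total degree less than `n`. -/
noncomputable def lowExponent {n : ℕ} (k : Σ k : Fin n, Fin (k + 1)) : Fin 2 →₀ ℕ :=
  Finsupp.single 0 (k.2 : ℕ) + Finsupp.single 1 ((k.1 : ℕ) - k.2)

lemma lowExponent_zero {n : ℕ} (k : Σ k : Fin n, Fin (k + 1)) : lowExponent k 0 = k.2 := by
  simp [lowExponent]

lemma lowExponent_one {n : ℕ} (k : Σ k : Fin n, Fin (k + 1)) :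
    lowExponent k 1 = (k.1 : ℕ) - k.2 := by
  simp [lowExponent]

lemma lowExponent_injective (n : ℕ) :
    Function.Injective (lowExponent : (Σ k : Fin n, Fin (k + 1)) → _) := by
  rintro ⟨⟨k, hk⟩, ⟨i, hi⟩⟩ ⟨⟨l, hl⟩, ⟨j, hj⟩⟩ h
  have h0 := DFunLike.congr_fun h 0
  have h1 := DFunLike.congr_fun h 1
  simp only [lowExponent_zero, lowExponent_one] at h0 h1 hi hj
  obtain rfl : i = j := h0
  obtain rfl : k = l := by lia
  rfl

lemma exists_lowExponent_eq {n : ℕ} {x : Fin 2 →₀ ℕ} (hx : x.degree < n) :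
    ∃ k : Σ k : Fin n, Fin (k + 1), lowExponent k = x := by
  have h : x.degree = x 0 + x 1 := by
    rw [Finsupp.degree_eq_sum, Fin.sum_univ_two]
  refine ⟨⟨⟨x.degree, hx⟩, ⟨x 0, by simp only; lia⟩⟩, ?_⟩
  ext i
  fin_cases i
  · exact lowExponent_zero _
  · refine (lowExponent_one _).trans ?_
    simp only [Fin.mk_one]
    lia

lemma card_sigma_fin (n : ℕ) :
    2 * (Fintype.card (Σ k : Fin n, Fin (k + 1)) : ℤ) = n * (n + 1) := by
  rw [Fintype.card_sigma]
  simp only [Fintype.card_fin]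
  rw [Fin.sum_univ_eq_sum_range (fun k => k + 1)]
  induction n with
  | zero => simp
  | succ n ih =>
    rw [Finset.sum_range_succ]
    push_cast at *
    linarith

variable (K a b c) in
/-- The coefficients of order less than `n` of the expansion along the curve of forms of
degree `d`. -/
noncomputable def truncTaylor (p q n d : ℕ) :
    symbPiece K a b c 0 d →ₗ[K] ((Σ k : Fin n, Fin (k + 1)) → K) :=
  (LinearMap.pi fun k => taylorCoeff a b c p q (lowExponent k) d) ∘ₗ (symbPiece K a b c 0 d).subtype

lemma map_ker_truncTaylor {p q : ℕ} (hpq : p * a = q * b + 1) (n d : ℕ) :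
    (LinearMap.ker (truncTaylor K a b c p q n d)).map (symbPiece K a b c 0 d).subtype =
      symbPiece K a b c n d := by
  ext f
  rw [Submodule.mem_map, mem_symbPiece, mem_symbPow_iff K a b c p q hpq,
    le_curveOrder_iff_taylorCoeff]
  constructor
  · rintro ⟨⟨f, hf⟩, h, rfl⟩
    refine ⟨fun x hx e => ?_, hf.2⟩
    obtain ⟨k, rfl⟩ := exists_lowExponent_eq hx
    by_cases he : (e : ℤ) = d
    · obtain rfl : e = d := by exact_mod_cast he
      exact congrFun h k
    · exact taylorCoeff_eq_zero _ _ _ he hf.2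
  · rintro ⟨h1, h2⟩
    refine ⟨⟨f, mem_symbPiece_zero.mpr h2⟩, ?_, rfl⟩
    ext k
    refine h1 _ ?_ d
    have := k.2.2
    have := k.1.2
    rw [Finsupp.degree_eq_sum, Fin.sum_univ_two, lowExponent_zero, lowExponent_one]
    lia

variable (ha : 0 < a) (hb : 0 < b) (hc : 0 < c) (hab : a.Coprime b)

section
include ha hb hc

lemma finite_symbPiece (n : ℕ) (d : ℤ) : Module.Finite K (symbPiece K a b c n d) := by
  obtain hd | hd := lt_or_ge d 0
  · rw [symbPiece_neg hd]
    infer_instance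
  · lift d to ℕ using hd
    have h : (weightedHomogeneousSubmodule K (wt a b c) d).FG :=
      weightedHomogeneousSubmodule_fg K _ (by intro i; fin_cases i <;> simp [wt] <;> lia) d
    have : Module.Finite K (weightedHomogeneousSubmodule K (wt a b c) d) :=
      Module.Finite.iff_fg.mpr h
    refine Submodule.finiteDimensional_of_le
      (S₂ := weightedHomogeneousSubmodule K (wt a b c) d) fun f hf => ?_
    exact isWeightedHomogeneous_intWt.mp hf.2

lemma symbDim_mono {m n : ℕ} (h : m ≤ n) (d : ℤ) :
    symbDim K a b c n d ≤ symbDim K a b c m d := by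
  have := finite_symbPiece (K := K) ha hb hc m d
  exact Nat.cast_le.mpr (Submodule.finrank_mono (symbPiece_anti h d))

lemma range_add_symbDim {p q : ℕ} (hpq : p * a = q * b + 1) (n d : ℕ) :
    (Module.finrank K (LinearMap.range (truncTaylor K a b c p q n d)) : ℤ) + symbDim K a b c n d =
      symbDim K a b c 0 d := by
  have := finite_symbPiece (K := K) ha hb hc 0 d
  have h := LinearMap.finrank_range_add_finrank_ker (truncTaylor K a b c p q n d)
  rw [← Submodule.finrank_map_subtype_eq, map_ker_truncTaylor hpq] at h
  rw [symbDim, symbDim, ← h, Nat.cast_add]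

include hab in
lemma symbDim_zero_le (n : ℕ) (d : ℤ) :
    2 * symbDim K a b c 0 d ≤ 2 * symbDim K a b c n d + n * (n + 1) := by
  obtain hd | hd := lt_or_ge d 0
  · rw [symbDim_neg hd, symbDim_neg hd]
    positivity
  · lift d to ℕ using hd
    obtain ⟨p, q, hpq⟩ := exists_mul_eq_mul_add_one ha hb hab
    rw [← card_sigma_fin, ← range_add_symbDim ha hb hc hpq n d,
      ← Module.finrank_fintype_fun_eq_card K]
    have := Submodule.finrank_le (LinearMap.range (truncTaylor K a b c p q n d))
    lia

end

lemma coeff_transversal_of_eq {A : Type*} [CommRing A] (r : A) (x : Fin 2 →₀ ℕ) (E : ℕ) :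
    coeff x (C r * (monomial x 1 * (1 + X 0) ^ E)) = r := by
  rw [coeff_C_mul, coeff_monomial_mul', if_pos le_rfl, tsub_self, one_mul]
  simp [← constantCoeff_eq]

lemma coeff_transversal_of_ne {A : Type*} [CommRing A] (r : A) {x y : Fin 2 →₀ ℕ} (E : ℕ)
    (hxy : x ≠ y) (h : x 0 ≤ y 0) :
    coeff x (C r * (monomial y 1 * (1 + X 0) ^ E)) = 0 := by
  rw [coeff_C_mul, coeff_monomial_mul']
  split_ifs with hle
  · have h0 : (x - y) 1 ≠ 0 := by
      intro h1
      apply hxy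
      ext i
      have := hle i
      fin_cases i
      · exact le_antisymm h this
      · simp at h1 this ⊢
        lia
    rw [one_mul, add_comm, add_pow, coeff_sum, Finset.sum_eq_zero, mul_zero]
    intro m _
    rw [one_pow, mul_one, mul_comm, ← C_eq_coe_nat, coeff_C_mul, coeff_X_pow, if_neg, mul_zero]
    intro h1
    apply h0
    rw [← h1]
    simp
  · exact mul_zero _

lemma exists_form_with_leading_exponent {p q : ℕ} (hpq : p * a = q * b + 1)
    (x : Fin 2 →₀ ℕ) (s t : ℕ) :
    ∃ (f : MvPolynomial (Fin 3) K) (E : ℕ),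
      f ∈ symbPiece K a b c 0 (a * b * x 0 + p * a * c * x 1 + a * s + b * t : ℕ) ∧
      taylor K a b c p q f =
        C (Polynomial.X ^ (a * b * x 0 + p * a * c * x 1 + a * s + b * t)) *
          (monomial x 1 * (1 + X 0) ^ E) := by
  have h1 : IsWeightedHomogeneous (wt a b c) (X 1 ^ a - X 0 ^ b : MvPolynomial (Fin 3) K)
      (a * b) := by
    refine IsWeightedHomogeneous.sub ?_ ?_
    · simpa [wt] using (isWeightedHomogeneous_X K (wt a b c) 1).pow a
    · simpa [wt, mul_comm] using (isWeightedHomogeneous_X K (wt a b c) 0).pow b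
  have h2 : IsWeightedHomogeneous (wt a b c)
      (X 2 * X 1 ^ (q * c) - X 0 ^ (p * c) : MvPolynomial (Fin 3) K) (p * a * c) := by
    refine IsWeightedHomogeneous.sub ?_ ?_
    · have := (isWeightedHomogeneous_X K (wt a b c) 2).mul
        ((isWeightedHomogeneous_X K (wt a b c) 1).pow (q * c))
      have e : p * a * c = wt a b c 2 + (q * c) • wt a b c 1 := by
        simp only [wt, Matrix.cons_val, smul_eq_mul, hpq]
        ring
      rwa [e]
    · have := (isWeightedHomogeneous_X K (wt a b c) 0).pow (p * c)
      have e : p * a * c = (p * c) • wt a b c 0 := by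
        simp only [wt, Matrix.cons_val, smul_eq_mul]
        ring
      rwa [e]
  have h3 : IsWeightedHomogeneous (wt a b c) (X 0 ^ s * X 1 ^ t : MvPolynomial (Fin 3) K)
      (a * s + b * t) := by
    have := ((isWeightedHomogeneous_X K (wt a b c) 0).pow s).mul
        ((isWeightedHomogeneous_X K (wt a b c) 1).pow t)
    convert this using 1
    simp [wt, mul_comm]
  refine ⟨(X 1 ^ a - X 0 ^ b) ^ x 0 * (X 2 * X 1 ^ (q * c) - X 0 ^ (p * c)) ^ x 1 *
    (X 0 ^ s * X 1 ^ t), q * b * x 0 + p * q * c * x 1 + q * s + p * t, ?_, ?_⟩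
  · rw [mem_symbPiece_zero, isWeightedHomogeneous_intWt]
    convert ((h1.pow (x 0)).mul (h2.pow (x 1))).mul h3 using 1
    simp
    ring
  · have e1 : taylor K a b c p q (X 1 ^ a - X 0 ^ b) =
        C (Polynomial.X ^ (a * b)) * ((1 + X 0) ^ (q * b) * X 0) := by
      have : ((1 + X 0 : MvPolynomial (Fin 2) (Polynomial K)) ^ p) ^ a =
          (1 + X 0) ^ (q * b) * (1 + X 0) := by rw [← pow_mul, hpq, pow_succ]
      simp only [taylor, map_sub, map_pow, aeval_X, Matrix.cons_val, mul_pow]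
      rw [this]
      ring
    have e2 : taylor K a b c p q (X 2 * X 1 ^ (q * c) - X 0 ^ (p * c)) =
        C (Polynomial.X ^ (p * a * c)) * ((1 + X 0) ^ (p * q * c) * X 1) := by
      simp only [taylor, map_sub, map_pow, map_mul, aeval_X, Matrix.cons_val, mul_pow, ← pow_mul]
      rw [hpq]
      have : (C (Polynomial.X : Polynomial K) : MvPolynomial (Fin 2) _) ^ (a * (p * c)) =
          C Polynomial.X ^ ((q * b + 1) * c) := by rw [← hpq]; ring
      rw [this]
      ring
    have e3 : (monomial x 1 : MvPolynomial (Fin 2) (Polynomial K)) = X 0 ^ x 0 * X 1 ^ x 1 := by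
      rw [monomial_eq, Finsupp.prod_fintype _ _ (by simp), Fin.prod_univ_two]
      simp
    have e4 : taylor K a b c p q (X 0 ^ s * X 1 ^ t) =
        C (Polynomial.X ^ (a * s + b * t)) * (1 + X 0) ^ (q * s + p * t) := by
      simp only [taylor, map_pow, map_mul, aeval_X, Matrix.cons_val, mul_pow, ← pow_mul]
      ring
    rw [map_mul, map_mul, map_pow, map_pow, e1, e2, e3, e4]
    simp only [mul_pow, map_pow]
    ring

include ha hb hc hab

lemma exists_symbDim_eq (n : ℕ) : ∃ D : ℤ, ∀ d ≥ D,
    2 * symbDim K a b c 0 d = 2 * symbDim K a b c n d + n * (n + 1) := by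
  obtain ⟨p, q, hpq⟩ := exists_mul_eq_mul_add_one ha hb hab
  refine ⟨((n * (a * b + p * a * c) + a * b : ℕ) : ℤ), fun d hd => ?_⟩
  lift d to ℕ using (Nat.cast_nonneg _).trans hd
  rw [ge_iff_le, Nat.cast_le] at hd
  have key : ∀ k : Σ k : Fin n, Fin (k + 1), ∃ (f : MvPolynomial (Fin 3) K) (E : ℕ),
      f ∈ symbPiece K a b c 0 d ∧ taylor K a b c p q f =
        C (Polynomial.X ^ d) * (monomial (lowExponent k) 1 * (1 + X 0) ^ E) := by
    intro k
    have hk : a * b * lowExponent k 0 + p * a * c * lowExponent k 1 ≤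
        n * (a * b + p * a * c) := by
      have h0 : lowExponent k 0 ≤ n := by
        have := k.2.2; have := k.1.2; rw [lowExponent_zero]; lia
      have h1 : lowExponent k 1 ≤ n := by
        have := k.1.2; rw [lowExponent_one]; lia
      calc _ ≤ a * b * n + p * a * c * n := by gcongr
        _ = _ := by ring
    obtain ⟨s, t, hst⟩ := exists_mul_add_mul_eq ha hb hab
      (m := d - (a * b * lowExponent k 0 + p * a * c * lowExponent k 1)) (by lia)
    obtain ⟨f, E, h⟩ := exists_form_with_leading_exponent (K := K) (c := c) hpq (lowExponent k) s t
    have hd' : a * b * lowExponent k 0 + p * a * c * lowExponent k 1 + a * s + b * t = d := by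
      lia
    rw [hd'] at h
    exact ⟨f, E, h⟩
  choose f E hf hfE using key
  have hcoeff : ∀ k l : Σ k : Fin n, Fin (k + 1), taylorCoeff a b c p q (lowExponent l) d (f k) =
      (coeff (lowExponent l) (C (Polynomial.X ^ d) *
        (monomial (lowExponent k) 1 * (1 + X 0) ^ E k)) : Polynomial K).coeff d := by
    intro k l
    rw [taylorCoeff_apply, hfE]
  let Ψ : ((Σ k : Fin n, Fin (k + 1)) → K) →ₗ[K] symbPiece K a b c 0 d :=
    Fintype.linearCombination K fun k => (⟨f k, hf k⟩ : symbPiece K a b c 0 d)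
  have hΨ : ∀ v l, truncTaylor K a b c p q n d (Ψ v) l =
      ∑ k, v k * taylorCoeff a b c p q (lowExponent l) d (f k) := by
    intro v l
    simp [Ψ, Fintype.linearCombination_apply, truncTaylor]
  have hinj : Function.Injective (truncTaylor K a b c p q n d ∘ₗ Ψ) := by
    rw [← LinearMap.ker_eq_bot, LinearMap.ker_eq_bot']
    intro v hv
    have main : ∀ i : ℕ, ∀ l, lowExponent l 0 = i → v l = 0 := by
      intro i
      induction i using Nat.strong_induction_on with
      | _ i ih =>
        intro l hl
        have h := congrFun hv l
        rw [LinearMap.comp_apply, hΨ, Finset.sum_eq_single l] at h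
        · rw [hcoeff, coeff_transversal_of_eq] at h
          simpa using h
        · intro k _ hkl
          by_cases hk : lowExponent k 0 < i
          · rw [ih _ hk k rfl, zero_mul]
          · rw [hcoeff, coeff_transversal_of_ne, Polynomial.coeff_zero, mul_zero]
            · exact fun h => hkl (lowExponent_injective n h.symm)
            · lia
        · simp
    exact funext fun l => main _ l rfl
  have hsurj : LinearMap.range (truncTaylor K a b c p q n d) = ⊤ := by
    rw [LinearMap.range_eq_top]
    exact Function.Surjective.of_comp (g := Ψ) (LinearMap.injective_iff_surjective.mp hinj)
  have := range_add_symbDim (K := K) ha hb hc hpq n d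
  rw [hsurj, finrank_top, Module.finrank_fintype_fun_eq_card] at this
  rw [← card_sigma_fin]
  lia

end Dimension

section TwoForms

variable {K : Type*} [Field K] {a b c : ℕ}

lemma isWeightedHomogeneous_of_mul {g f : MvPolynomial (Fin 3) K} {d e : ℤ} (hg0 : g ≠ 0)
    (hg : IsWeightedHomogeneous (intWt a b c) g d)
    (hgf : IsWeightedHomogeneous (intWt a b c) (g * f) e) :
    IsWeightedHomogeneous (intWt a b c) f (e - d) := by
  have h1 := weightedHomogeneousComponent_mul hg e f
  rw [hgf.weightedHomogeneousComponent_same] at h1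
  rw [mul_left_cancel₀ hg0 h1]
  exact weightedHomogeneousComponent_isWeightedHomogeneous _ _

lemma HasOrder.ne_zero {g : MvPolynomial (Fin 3) K} {o : ℕ} (hg : HasOrder a b c g o) : g ≠ 0 := by
  rintro rfl
  exact hg.2 (Ideal.zero_mem _)

variable (ha : 0 < a) (hb : 0 < b) (hc : 0 < c) (hab : a.Coprime b)

include ha hb hab in
lemma HasOrder.mul_mem_symbPiece_iff {g f : MvPolynomial (Fin 3) K} {o n : ℕ} {d e : ℤ}
    (hg : HasOrder a b c g o) (hgd : IsWeightedHomogeneous (intWt a b c) g e) :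
    g * f ∈ symbPiece K a b c n d ↔ f ∈ symbPiece K a b c (n - o) (d - e) := by
  rw [mem_symbPiece, mem_symbPiece, hg.mul_mem_iff ha hb hab]
  refine and_congr_right fun _ => ⟨isWeightedHomogeneous_of_mul hg.ne_zero hgd, fun h => ?_⟩
  have := hgd.mul h
  rwa [add_sub_cancel] at this

/-- Multiplication by `g` on a subspace. -/
noncomputable def mulImage (g : MvPolynomial (Fin 3) K)
    (V : Submodule K (MvPolynomial (Fin 3) K)) : Submodule K (MvPolynomial (Fin 3) K) :=
  V.map (LinearMap.mulLeft K g)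

lemma mem_mulImage {g f : MvPolynomial (Fin 3) K} {V : Submodule K (MvPolynomial (Fin 3) K)} :
    f ∈ mulImage g V ↔ ∃ v ∈ V, g * v = f := Iff.rfl

lemma finrank_mulImage {g : MvPolynomial (Fin 3) K} (hg : g ≠ 0)
    (V : Submodule K (MvPolynomial (Fin 3) K)) :
    Module.finrank K (mulImage g V) = Module.finrank K V :=
  (Submodule.equivMapOfInjective _ (mul_right_injective₀ hg) V).finrank_eq.symm

variable {g₁ g₂ : MvPolynomial (Fin 3) K} {o₁ o₂ : ℕ} {d₁ d₂ : ℤ}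
  (h₁ : HasOrder a b c g₁ o₁) (h₂ : HasOrder a b c g₂ o₂)
  (hd₁ : IsWeightedHomogeneous (intWt a b c) g₁ d₁)
  (hd₂ : IsWeightedHomogeneous (intWt a b c) g₂ d₂)

include ha hb hab h₁ h₂ hd₁ hd₂

lemma mulImage_sup_le (n : ℕ) (d : ℤ) :
    mulImage g₁ (symbPiece K a b c (n - o₁) (d - d₁)) ⊔
      mulImage g₂ (symbPiece K a b c (n - o₂) (d - d₂)) ≤ symbPiece K a b c n d := by
  refine sup_le ?_ ?_
  · rintro _ ⟨f, hf, rfl⟩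
    exact (h₁.mul_mem_symbPiece_iff ha hb hab hd₁).mpr hf
  · rintro _ ⟨f, hf, rfl⟩
    exact (h₂.mul_mem_symbPiece_iff ha hb hab hd₂).mpr hf

variable (hrel : IsRelPrime g₁ g₂)
include hrel

lemma mulImage_inf_eq (n : ℕ) (d : ℤ) :
    mulImage g₁ (symbPiece K a b c (n - o₁) (d - d₁)) ⊓
      mulImage g₂ (symbPiece K a b c (n - o₂) (d - d₂)) =
    mulImage (g₁ * g₂) (symbPiece K a b c (n - o₁ - o₂) (d - d₁ - d₂)) := by
  ext f
  rw [Submodule.mem_inf, mem_mulImage, mem_mulImage, mem_mulImage]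
  constructor
  · rintro ⟨⟨u, hu, rfl⟩, v, hv, huv⟩
    obtain ⟨w, rfl⟩ : g₂ ∣ u :=
      hrel.symm.dvd_of_dvd_mul_left (Dvd.intro _ huv)
    exact ⟨w, (h₂.mul_mem_symbPiece_iff ha hb hab hd₂).mp hu, by ring⟩
  · rintro ⟨w, hw, rfl⟩
    refine ⟨⟨g₂ * w, (h₂.mul_mem_symbPiece_iff ha hb hab hd₂).mpr hw, by ring⟩,
      ⟨g₁ * w, (h₁.mul_mem_symbPiece_iff ha hb hab hd₁).mpr ?_, by ring⟩⟩
    rwa [Nat.sub_right_comm, sub_right_comm]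

include hc

lemma finrank_mulImage_sup (n : ℕ) (d : ℤ) :
    (Module.finrank K (mulImage g₁ (symbPiece K a b c (n - o₁) (d - d₁)) ⊔
      mulImage g₂ (symbPiece K a b c (n - o₂) (d - d₂)) :
        Submodule K (MvPolynomial (Fin 3) K)) : ℤ) =
    symbDim K a b c (n - o₁) (d - d₁) + symbDim K a b c (n - o₂) (d - d₂) -
      symbDim K a b c (n - o₁ - o₂) (d - d₁ - d₂) := by
  have := finite_symbPiece (K := K) ha hb hc (n - o₁) (d - d₁)
  have := finite_symbPiece (K := K) ha hb hc (n - o₂) (d - d₂)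
  have f₁ : Module.Finite K (mulImage g₁ (symbPiece K a b c (n - o₁) (d - d₁))) :=
    Module.Finite.map _ _
  have f₂ : Module.Finite K (mulImage g₂ (symbPiece K a b c (n - o₂) (d - d₂))) :=
    Module.Finite.map _ _
  have h := Submodule.finrank_sup_add_finrank_inf_eq
    (mulImage g₁ (symbPiece K a b c (n - o₁) (d - d₁)))
    (mulImage g₂ (symbPiece K a b c (n - o₂) (d - d₂)))
  rw [mulImage_inf_eq ha hb hab h₁ h₂ hd₁ hd₂ hrel, finrank_mulImage h₁.ne_zero,
    finrank_mulImage h₂.ne_zero, finrank_mulImage (mul_ne_zero h₁.ne_zero h₂.ne_zero)] at h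
  simp only [symbDim]
  lia

lemma symbDim_add_le (n : ℕ) (d : ℤ) :
    symbDim K a b c (n - o₁) (d - d₁) + symbDim K a b c (n - o₂) (d - d₂) -
      symbDim K a b c (n - o₁ - o₂) (d - d₁ - d₂) ≤ symbDim K a b c n d := by
  rw [← finrank_mulImage_sup ha hb hc hab h₁ h₂ hd₁ hd₂ hrel]
  have := finite_symbPiece (K := K) ha hb hc n d
  exact Nat.cast_le.mpr (Submodule.finrank_mono (mulImage_sup_le ha hb hab h₁ h₂ hd₁ hd₂ n d))

lemma exists_eq_add_of_symbDim_eq {n : ℕ} {d : ℤ}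
    (h : symbDim K a b c (n - o₁) (d - d₁) + symbDim K a b c (n - o₂) (d - d₂) -
      symbDim K a b c (n - o₁ - o₂) (d - d₁ - d₂) = symbDim K a b c n d)
    {f : MvPolynomial (Fin 3) K} (hf : f ∈ symbPiece K a b c n d) :
    ∃ u ∈ symbPiece K a b c (n - o₁) (d - d₁), ∃ v ∈ symbPiece K a b c (n - o₂) (d - d₂),
      f = g₁ * u + g₂ * v := by
  rw [← finrank_mulImage_sup ha hb hc hab h₁ h₂ hd₁ hd₂ hrel, symbDim, Nat.cast_inj] at h
  have := finite_symbPiece (K := K) ha hb hc n d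
  rw [← Submodule.eq_of_le_of_finrank_eq (mulImage_sup_le ha hb hab h₁ h₂ hd₁ hd₂ n d) h,
    Submodule.mem_sup] at hf
  obtain ⟨_, ⟨u, hu, rfl⟩, _, ⟨v, hv, rfl⟩, rfl⟩ := hf
  exact ⟨u, hu, v, hv, rfl⟩

end TwoForms

section BoxSums

variable {K : Type*} [Field K] {a b c : ℕ}

lemma symbDim_zero_eq_card (d : ℤ) : symbDim K a b c 0 d =
    Nat.card {m : Fin 3 → ℕ // ∑ i, (wt a b c i * m i : ℤ) = d} := by
  have h : symbPiece K a b c 0 d =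
      restrictSupport K {m : Fin 3 →₀ ℕ | Finsupp.weight (intWt a b c) m = d} := by
    rw [restrictSupport, ← weightedHomogeneousSubmodule_eq_finsupp_supported]
    ext f
    exact mem_symbPiece_zero
  rw [symbDim, h, Module.finrank_eq_nat_card_basis (basisRestrictSupport K _)]
  congr 1
  refine Nat.card_congr (Equiv.subtypeEquiv Finsupp.equivFunOnFinite fun m => ?_)
  simp [Finsupp.weight_apply, Finsupp.sum_fintype, intWt, mul_comm]

lemma card_sum_eq (d : ℕ) :
    2 * (Nat.card {m : Fin 3 → ℕ // ∑ i, (m i : ℤ) = d} : ℤ) = (d + 1) * (d + 2) := by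
  have h : Nat.card {m : Fin 3 → ℕ // ∑ i, (m i : ℤ) = d} =
      (Finset.finsuppAntidiag (Finset.univ : Finset (Fin 3)) d).card := by
    rw [← Nat.card_eq_finsetCard]
    refine (Nat.card_congr (Equiv.subtypeEquiv Finsupp.equivFunOnFinite fun m => ?_)).symm
    rw [Finset.mem_finsuppAntidiag]
    simp only [Finsupp.equivFunOnFinite_apply, Finset.subset_univ, and_true]
    norm_cast
  rw [h, Finset.card_finsuppAntidiag_nat_eq_choose]
  have : (d + 2).choose 2 * 2 = (d + 2) * (d + 1) := by
    rw [Nat.choose_two_right, Nat.div_mul_cancel]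
    · rfl
    · exact (Nat.even_mul_pred_self _).two_dvd
  have h2 : (d + 2).choose d = (d + 2).choose 2 := Nat.choose_symm_add
  have h3 : Finset.card (Finset.univ : Finset (Fin 3)) + d - 1 = d + 2 := by simp; lia
  rw [h3, h2]
  zify at this
  linarith

variable (a b c) in
/-- The sum of the values of `u` over a box of shifts. -/
def boxSum (u : ℤ → ℤ) (d : ℤ) : ℤ :=
  ∑ t : (i : Fin 3) → Fin (wt a b c i), u (d - ∑ i, (t i : ℤ))

lemma card_box : Fintype.card ((i : Fin 3) → Fin (wt a b c i)) = a * b * c := by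
  rw [Fintype.card_pi, Fin.prod_univ_three]
  simp only [Fintype.card_fin]
  rfl

lemma box_le (t : (i : Fin 3) → Fin (wt a b c i)) :
    0 ≤ ∑ i, (t i : ℤ) ∧ ∑ i, (t i : ℤ) ≤ a + b + c := by
  refine ⟨by positivity, ?_⟩
  have h := fun i => (t i).2
  have h0 := h 0
  have h1 := h 1
  have h2 := h 2
  rw [Fin.sum_univ_three]
  simp [wt] at h0 h1 h2 ⊢
  lia

variable (ha : 0 < a) (hb : 0 < b) (hc : 0 < c)

include ha hb hc

lemma boxSum_symbDim_zero {d : ℤ} (hd : 0 ≤ d) :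
    2 * boxSum a b c (symbDim K a b c 0) d = (d + 1) * (d + 2) := by
  have hw : ∀ i, 0 < wt a b c i := by intro i; fin_cases i <;> simp [wt] <;> lia
  lift d to ℕ using hd
  rw [← card_sum_eq, boxSum]
  simp_rw [symbDim_zero_eq_card]
  let F : (Σ t : (i : Fin 3) → Fin (wt a b c i),
      {m : Fin 3 → ℕ // ∑ i, (wt a b c i * m i : ℤ) = d - ∑ i, (t i : ℤ)}) →
      {m : Fin 3 → ℕ // ∑ i, (m i : ℤ) = d} := fun x =>
    ⟨fun i => wt a b c i * x.2.1 i + x.1 i, by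
      have := x.2.2
      push_cast
      rw [Finset.sum_add_distrib]
      lia⟩
  have hF : Function.Bijective F := by
    constructor
    · rintro ⟨t, m, hm⟩ ⟨t', m', hm'⟩ h
      have h' : ∀ i, wt a b c i * m i + t i = wt a b c i * m' i + t' i :=
        fun i => congrFun (congrArg Subtype.val h) i
      obtain rfl : t = t' := by
        funext i
        have := congrArg (· % wt a b c i) (h' i)
        simpa [Nat.mul_add_mod, Nat.mod_eq_of_lt (t i).2, Nat.mod_eq_of_lt (t' i).2,
          Fin.ext_iff] using this
      obtain rfl : m = m' := by
        funext i
        exact Nat.eq_of_mul_eq_mul_left (hw i) (Nat.add_right_cancel (h' i))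
      rfl
    · rintro ⟨m, hm⟩
      refine ⟨⟨fun i => ⟨m i % wt a b c i, Nat.mod_lt _ (hw i)⟩,
        fun i => m i / wt a b c i, ?_⟩, ?_⟩
      · rw [eq_sub_iff_add_eq, ← Finset.sum_add_distrib, ← hm]
        refine Finset.sum_congr rfl fun i _ => ?_
        exact_mod_cast Nat.div_add_mod _ _
      · apply Subtype.ext
        funext i
        exact Nat.div_add_mod _ _
  have fin : ∀ e : ℤ, Finite {m : Fin 3 → ℕ // ∑ i, (wt a b c i * m i : ℤ) = e} := by
    intro e
    refine Set.Finite.subset (Set.finite_Iic (fun _ : Fin 3 => e.toNat)) ?_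
    intro m hm i
    have h1 : (wt a b c i * m i : ℤ) ≤ e := by
      rw [← show _ = e from hm]
      exact Finset.single_le_sum (f := fun i => (wt a b c i * m i : ℤ))
        (fun j _ => by positivity) (Finset.mem_univ i)
    have h2 : (1 : ℤ) ≤ wt a b c i := by exact_mod_cast hw i
    have h3 : (m i : ℤ) ≤ wt a b c i * m i := le_mul_of_one_le_left (by positivity) h2
    simp only
    lia
  rw [← Nat.card_eq_of_bijective F hF, Nat.card_sigma]
  push_cast
  rfl

lemma boxSum_second_difference {d e₁ e₂ : ℤ} (h₁ : 0 ≤ e₁) (h₂ : 0 ≤ e₂) (hd : e₁ + e₂ ≤ d) :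
    boxSum a b c (fun d => symbDim K a b c 0 d - symbDim K a b c 0 (d - e₁) -
      symbDim K a b c 0 (d - e₂) + symbDim K a b c 0 (d - e₁ - e₂)) d = e₁ * e₂ := by
  have k0 := boxSum_symbDim_zero (K := K) ha hb hc (d := d) (by lia)
  have k1 := boxSum_symbDim_zero (K := K) ha hb hc (d := d - e₁) (by lia)
  have k2 := boxSum_symbDim_zero (K := K) ha hb hc (d := d - e₂) (by lia)
  have k3 := boxSum_symbDim_zero (K := K) ha hb hc (d := d - e₁ - e₂) (by lia)
  have k : boxSum a b c (fun d => symbDim K a b c 0 d - symbDim K a b c 0 (d - e₁) -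
      symbDim K a b c 0 (d - e₂) + symbDim K a b c 0 (d - e₁ - e₂)) d =
      boxSum a b c (symbDim K a b c 0) d - boxSum a b c (symbDim K a b c 0) (d - e₁) -
      boxSum a b c (symbDim K a b c 0) (d - e₂) +
      boxSum a b c (symbDim K a b c 0) (d - e₁ - e₂) := by
    simp only [boxSum, Finset.sum_add_distrib, Finset.sum_sub_distrib, sub_right_comm]
  rw [k]
  linarith

end BoxSums

section Bezout

variable {K : Type*} [Field K] {a b c : ℕ} (ha : 0 < a) (hb : 0 < b) (hc : 0 < c)
  (hab : a.Coprime b) {g₁ g₂ : MvPolynomial (Fin 3) K} {o₁ o₂ : ℕ} {d₁ d₂ : ℕ}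
  (h₁ : HasOrder a b c g₁ o₁) (h₂ : HasOrder a b c g₂ o₂)
  (hd₁ : IsWeightedHomogeneous (intWt a b c) g₁ d₁)
  (hd₂ : IsWeightedHomogeneous (intWt a b c) g₂ d₂)
  (hrel : IsRelPrime g₁ g₂)

include ha hb hc hab h₁ h₂ hd₁ hd₂ hrel

lemma exists_mul_le_second_difference : ∃ D : ℤ, ∀ d ≥ D,
    (o₁ * o₂ : ℤ) ≤ symbDim K a b c 0 d - symbDim K a b c 0 (d - d₁) -
      symbDim K a b c 0 (d - d₂) + symbDim K a b c 0 (d - d₁ - d₂) := by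
  obtain ⟨D₁, hD₁⟩ := exists_symbDim_eq (K := K) ha hb hc hab o₁
  obtain ⟨D₂, hD₂⟩ := exists_symbDim_eq (K := K) ha hb hc hab o₂
  obtain ⟨D₃, hD₃⟩ := exists_symbDim_eq (K := K) ha hb hc hab (o₁ + o₂)
  refine ⟨max (max (D₁ + d₂) (D₂ + d₁)) D₃, fun d hd => ?_⟩
  have e1 := hD₁ (d - d₂) (by lia)
  have e2 := hD₂ (d - d₁) (by lia)
  have e3 := hD₃ d (by lia)
  have h := symbDim_add_le ha hb hc hab h₁ h₂ hd₁ hd₂ hrel (o₁ + o₂) d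
  rw [Nat.add_sub_cancel_left, Nat.sub_self, Nat.add_sub_cancel] at h
  push_cast at e3
  nlinarith

/-- The Bezout-type inequality for two forms without common factors. -/
lemma mul_orders_le : a * b * c * (o₁ * o₂) ≤ d₁ * d₂ := by
  obtain ⟨D, hD⟩ := exists_mul_le_second_difference ha hb hc hab h₁ h₂ hd₁ hd₂ hrel
  have h := boxSum_second_difference (K := K) ha hb hc (d := max ((d₁ : ℤ) + d₂) (D + a + b + c))
    (Nat.cast_nonneg d₁) (Nat.cast_nonneg d₂) (by lia)
  have h' := Finset.card_nsmul_le_sum Finset.univ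
    (fun t : (i : Fin 3) → Fin (wt a b c i) => (fun d : ℤ => symbDim K a b c 0 d -
      symbDim K a b c 0 (d - d₁) - symbDim K a b c 0 (d - d₂) + symbDim K a b c 0 (d - d₁ - d₂))
      (max ((d₁ : ℤ) + d₂) (D + a + b + c) - ∑ i, (t i : ℤ))) (o₁ * o₂ : ℤ) (fun t _ => by
        have := box_le t
        exact hD _ (by lia))
  rw [boxSum] at h
  rw [h, Finset.card_univ, card_box, nsmul_eq_mul] at h'
  exact_mod_cast h'

lemma exists_second_difference_eq (heq : d₁ * d₂ = a * b * c * (o₁ * o₂)) :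
    ∃ D : ℤ, ∀ d ≥ D,
    symbDim K a b c 0 d - symbDim K a b c 0 (d - d₁) -
      symbDim K a b c 0 (d - d₂) + symbDim K a b c 0 (d - d₁ - d₂) = o₁ * o₂ := by
  obtain ⟨D, hD⟩ := exists_mul_le_second_difference ha hb hc hab h₁ h₂ hd₁ hd₂ hrel
  refine ⟨max ((d₁ : ℤ) + d₂) (D + a + b + c), fun d hd => ?_⟩
  have h := boxSum_second_difference (K := K) ha hb hc (d := d)
    (Nat.cast_nonneg d₁) (Nat.cast_nonneg d₂) (by lia)
  have h' : ∑ t : (i : Fin 3) → Fin (wt a b c i), (o₁ * o₂ : ℤ) = d₁ * d₂ := by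
    rw [Finset.sum_const, Finset.card_univ, card_box, nsmul_eq_mul]
    exact_mod_cast heq.symm
  rw [boxSum, ← h', eq_comm, Finset.sum_eq_sum_iff_of_le] at h
  · have hw : ∀ i, 0 < wt a b c i := by intro i; fin_cases i <;> simp [wt] <;> lia
    simpa using (h (fun i => ⟨0, hw i⟩) (Finset.mem_univ _)).symm
  · intro t _
    have := box_le t
    exact hD _ (by lia)

/-- In high degrees, symbolic powers are generated by two forms satisfying Huneke's equality. -/
lemma exists_decomposition (heq : d₁ * d₂ = a * b * c * (o₁ * o₂)) {n : ℕ} (hn : o₁ + o₂ ≤ n) :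
    ∃ D : ℤ, ∀ d ≥ D, ∀ f ∈ symbPiece K a b c n d,
      ∃ u ∈ symbPiece K a b c (n - o₁) (d - d₁), ∃ v ∈ symbPiece K a b c (n - o₂) (d - d₂),
        f = g₁ * u + g₂ * v := by
  obtain ⟨D, hD⟩ := exists_second_difference_eq ha hb hc hab h₁ h₂ hd₁ hd₂ hrel heq
  obtain ⟨D₀, hD₀⟩ := exists_symbDim_eq (K := K) ha hb hc hab n
  obtain ⟨D₁, hD₁⟩ := exists_symbDim_eq (K := K) ha hb hc hab (n - o₁)
  obtain ⟨D₂, hD₂⟩ := exists_symbDim_eq (K := K) ha hb hc hab (n - o₂)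
  obtain ⟨D₃, hD₃⟩ := exists_symbDim_eq (K := K) ha hb hc hab (n - o₁ - o₂)
  refine ⟨max (max D D₀) (max (max (D₁ + d₁) (D₂ + d₂)) (D₃ + d₁ + d₂)), fun d hd f hf => ?_⟩
  refine exists_eq_add_of_symbDim_eq ha hb hc hab h₁ h₂ hd₁ hd₂ hrel ?_ hf
  have e := hD d (by lia)
  have e0 := hD₀ d (by lia)
  have e1 := hD₁ (d - d₁) (by lia)
  have e2 := hD₂ (d - d₂) (by lia)
  have e3 := hD₃ (d - d₁ - d₂) (by lia)
  obtain ⟨m, rfl⟩ := Nat.exists_eq_add_of_le hn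
  have k1 : o₁ + o₂ + m - o₁ = o₂ + m := by lia
  have k2 : o₁ + o₂ + m - o₂ = o₁ + m := by lia
  have k3 : o₂ + m - o₂ = m := by lia
  rw [k1] at e1 e3 ⊢
  rw [k2] at e2 ⊢
  rw [k3] at e3 ⊢
  push_cast at *
  linarith

end Bezout

section QuasiRegular

variable {R : Type*} [CommRing R] [IsDomain R] [DecompositionMonoid R] {g₁ g₂ : R}

lemma exists_eq_mul_of_isRelPrime {p q u v : R} (h : IsRelPrime p q) (huv : u * p + v * q = 0) :
    ∃ w, u = w * q ∧ v = -(w * p) := by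
  have hdvd : p ∣ v :=
    h.dvd_of_dvd_mul_right ⟨-u, by linear_combination huv⟩
  obtain ⟨t, rfl⟩ := hdvd
  obtain rfl | hp := eq_or_ne p 0
  · obtain ⟨e, rfl⟩ := isRelPrime_zero_left.mp h
    exact ⟨u * ↑e⁻¹, by simp, by simp⟩
  · refine ⟨-t, mul_right_cancel₀ hp ?_, by ring⟩
    linear_combination huv

lemma mem_span_pair_of_sum_eq_zero (h : IsRelPrime g₁ g₂) (n : ℕ) (c : ℕ → R)
    (hc : ∑ i ∈ Finset.range (n + 1), c i * (g₁ ^ i * g₂ ^ (n - i)) = 0) :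
    ∀ i ≤ n, c i ∈ Ideal.span {g₁, g₂} := by
  induction n generalizing c with
  | zero =>
    intro i hi
    obtain rfl : i = 0 := by lia
    simp at hc
    simp [hc]
  | succ n ih =>
    rw [Finset.sum_range_succ, Nat.sub_self, pow_zero, mul_one] at hc
    have h1 : ∑ i ∈ Finset.range (n + 1), c i * (g₁ ^ i * g₂ ^ (n + 1 - i)) =
        (∑ i ∈ Finset.range (n + 1), c i * (g₁ ^ i * g₂ ^ (n - i))) * g₂ := by
      rw [Finset.sum_mul]
      refine Finset.sum_congr rfl fun i hi => ?_
      rw [Nat.succ_sub (Nat.lt_succ_iff.mp (Finset.mem_range.mp hi)), pow_succ]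
      ring
    rw [h1, add_comm] at hc
    obtain ⟨w, hw, hw'⟩ := exists_eq_mul_of_isRelPrime (h.pow_left (m := n + 1)) hc
    have key := ih (fun i => c i + if i = n then w * g₁ else 0) (by
      simp only [add_mul, Finset.sum_add_distrib, hw', ite_mul, zero_mul, Finset.sum_ite_eq',
        Finset.mem_range, Nat.lt_succ_self, if_true, Nat.sub_self]
      ring)
    intro i hi
    have hg₁ : g₁ ∈ Ideal.span {g₁, g₂} := Ideal.subset_span (by simp)
    have hg₂ : g₂ ∈ Ideal.span {g₁, g₂} := Ideal.subset_span (by simp)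
    obtain rfl | hi := eq_or_lt_of_le hi
    · rw [hw]
      exact Ideal.mul_mem_left _ _ hg₂
    · have := key i (by lia)
      refine (Ideal.add_mem_iff_left _ ?_).mp this
      split_ifs
      · exact Ideal.mul_mem_left _ _ hg₁
      · exact Ideal.zero_mem _

omit [IsDomain R] [DecompositionMonoid R] in
lemma exists_sum_eq_of_mem_pow_mul (n : ℕ) (J : Ideal R) {f : R}
    (hf : f ∈ Ideal.span {g₁, g₂} ^ n * J) : ∃ c : ℕ → R, (∀ i, c i ∈ J) ∧
      f = ∑ i ∈ Finset.range (n + 1), c i * (g₁ ^ i * g₂ ^ (n - i)) := by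
  induction n generalizing J with
  | zero => exact ⟨fun _ => f, fun _ => by simpa using hf, by simp⟩
  | succ n ih =>
    rw [pow_succ, mul_assoc] at hf
    obtain ⟨c, hc, rfl⟩ := ih _ hf
    have h (i : ℕ) : ∃ u ∈ J, ∃ v ∈ J, g₁ * u + g₂ * v = c i := by
      have := hc i
      rw [Ideal.span_insert, Ideal.sup_mul, Submodule.mem_sup] at this
      obtain ⟨y, hy, z, hz, hyz⟩ := this
      obtain ⟨u, hu, rfl⟩ := Ideal.mem_span_singleton_mul.mp hy
      obtain ⟨v, hv, rfl⟩ := Ideal.mem_span_singleton_mul.mp hz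
      exact ⟨u, hu, v, hv, hyz⟩
    choose u hu v hv huv using h
    refine ⟨fun i => (if i = n + 1 then 0 else v i) + if i = 0 then 0 else u (i - 1),
      fun i => add_mem ?_ ?_, ?_⟩
    · split_ifs
      exacts [J.zero_mem, hv i]
    · split_ifs
      exacts [J.zero_mem, hu _]
    · simp only [add_mul, Finset.sum_add_distrib]
      rw [Finset.sum_range_succ _ (n + 1), Finset.sum_range_succ' _ (n + 1)]
      simp only [if_true, zero_mul, add_zero, Nat.add_sub_cancel, Nat.succ_ne_zero, if_false]
      rw [← Finset.sum_add_distrib]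
      refine Finset.sum_congr rfl fun i hi => ?_
      have hi := Finset.mem_range.mp hi
      rw [if_neg hi.ne, ← huv, Nat.succ_sub (Nat.lt_succ_iff.mp hi), Nat.succ_eq_add_one,
        Nat.add_sub_add_right]
      ring

omit [IsDomain R] [DecompositionMonoid R] in
lemma sum_mem_pow_succ (n : ℕ) {c : ℕ → R} (hc : ∀ i ≤ n, c i ∈ Ideal.span {g₁, g₂}) :
    ∑ i ∈ Finset.range (n + 1), c i * (g₁ ^ i * g₂ ^ (n - i)) ∈
      Ideal.span {g₁, g₂} ^ (n + 1) := by
  refine Ideal.sum_mem _ fun i hi => ?_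
  have hi : i ≤ n := Nat.lt_succ_iff.mp (Finset.mem_range.mp hi)
  have h : i + (n - i) = n := Nat.add_sub_of_le hi
  rw [pow_succ', ← h, pow_add, h]
  exact Ideal.mul_mem_mul (hc i hi) (Ideal.mul_mem_mul
    (Ideal.pow_mem_pow (Ideal.subset_span (by simp)) _)
    (Ideal.pow_mem_pow (Ideal.subset_span (by simp)) _))

lemma mem_span_pair_pow_of_mul_mem (h : IsRelPrime g₁ g₂) {x : R}
    (hx : ∀ f, x * f ∈ Ideal.span {g₁, g₂} → f ∈ Ideal.span {g₁, g₂}) (n : ℕ) {f : R}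
    (hf : x * f ∈ Ideal.span {g₁, g₂} ^ n) : f ∈ Ideal.span {g₁, g₂} ^ n := by
  induction n with
  | zero => simp
  | succ n ih =>
    have h1 := ih (Ideal.pow_le_pow_right n.le_succ hf)
    rw [← Ideal.mul_top (_ ^ n)] at h1
    obtain ⟨c, -, rfl⟩ := exists_sum_eq_of_mem_pow_mul n ⊤ h1
    rw [pow_succ] at hf
    obtain ⟨e, he, hfe⟩ := exists_sum_eq_of_mem_pow_mul n _ hf
    refine sum_mem_pow_succ n fun i hi => hx _ ?_
    have key := mem_span_pair_of_sum_eq_zero h n (fun i => x * c i - e i) (by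
      simp only [sub_mul, Finset.sum_sub_distrib, ← hfe, Finset.mul_sum, mul_assoc, sub_self])
      i hi
    simpa using add_mem key (he i)

end QuasiRegular

section Restriction

variable {K : Type*} [Field K]

variable (K) in
/-- The substitution `x ↦ 0`. -/
noncomputable def killX : MvPolynomial (Fin 3) K →ₐ[K] MvPolynomial (Fin 3) K :=
  aeval ![0, X 1, X 2]

lemma X_dvd_sub_killX (f : MvPolynomial (Fin 3) K) : X 0 ∣ f - killX K f := by
  have h : (Ideal.Quotient.mkₐ K (Ideal.span {X 0})).comp (killX K) =
      Ideal.Quotient.mkₐ K (Ideal.span {(X 0 : MvPolynomial (Fin 3) K)}) := by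
    ext i
    fin_cases i
    · simp [killX, Ideal.Quotient.eq_zero_iff_mem.mpr (Ideal.mem_span_singleton_self _)]
    · simp [killX]
    · simp [killX]
  rw [← Ideal.mem_span_singleton, ← Ideal.Quotient.eq]
  exact (DFunLike.congr_fun h f).symm

lemma killX_X_mul (f : MvPolynomial (Fin 3) K) : killX K (X 0 * f) = 0 := by
  simp [killX]

lemma killX_killX (f : MvPolynomial (Fin 3) K) : killX K (killX K f) = killX K f := by
  obtain ⟨g, hg⟩ := X_dvd_sub_killX f
  have h := killX_X_mul g
  rw [← hg, map_sub, sub_eq_zero] at h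
  exact h.symm

lemma X_dvd_of_killX_eq_zero {f : MvPolynomial (Fin 3) K} (h : killX K f = 0) : X 0 ∣ f := by
  simpa [h] using X_dvd_sub_killX f

lemma mem_span_pair_of_X_mul_mem {g₁ g₂ : MvPolynomial (Fin 3) K}
    (h : IsRelPrime (killX K g₁) (killX K g₂)) (f : MvPolynomial (Fin 3) K)
    (hf : X 0 * f ∈ Ideal.span {g₁, g₂}) : f ∈ Ideal.span {g₁, g₂} := by
  obtain ⟨u, v, huv⟩ := Ideal.mem_span_pair.mp hf
  have h0 : killX K u * killX K g₁ + killX K v * killX K g₂ = 0 := by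
    rw [← map_mul, ← map_mul, ← map_add, huv, killX_X_mul]
  obtain ⟨w, hu, hv⟩ := exists_eq_mul_of_isRelPrime h h0
  have hu' : killX K (u - killX K w * g₂) = 0 := by
    have := congrArg (killX K) hu
    rw [killX_killX, map_mul, killX_killX] at this
    rw [map_sub, map_mul, killX_killX, this, sub_self]
  have hv' : killX K (v + killX K w * g₁) = 0 := by
    have := congrArg (killX K) hv
    rw [killX_killX, map_neg, map_mul, killX_killX] at this
    rw [map_add, map_mul, killX_killX, this, neg_add_cancel]
  obtain ⟨s, hs⟩ := X_dvd_of_killX_eq_zero hu'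
  obtain ⟨t, ht⟩ := X_dvd_of_killX_eq_zero hv'
  refine Ideal.mem_span_pair.mpr ⟨s, t, mul_left_cancel₀ (X_ne_zero 0) ?_⟩
  linear_combination huv - g₁ * hs - g₂ * ht

end Restriction

section Huneke

variable {K : Type*} [Field K] {a b c : ℕ}

lemma X_one_pow_sub_mem_pIdeal :
    (X 1 ^ a - X 0 ^ b : MvPolynomial (Fin 3) K) ∈ pIdeal K a b c := by
  simp [pIdeal, toPoly, RingHom.mem_ker, ← pow_mul, mul_comm]

lemma X_two_pow_sub_mem_pIdeal :
    (X 2 ^ a - X 0 ^ c : MvPolynomial (Fin 3) K) ∈ pIdeal K a b c := by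
  simp [pIdeal, toPoly, RingHom.mem_ker, ← pow_mul, mul_comm]

lemma isWeightedHomogeneous_X_pow (i : Fin 3) (n : ℕ) :
    IsWeightedHomogeneous (intWt a b c) (X i ^ n : MvPolynomial (Fin 3) K) (n * intWt a b c i) := by
  simpa using (isWeightedHomogeneous_X K (intWt a b c) i).pow n

lemma isWeightedHomogeneous_X_one_pow_sub :
    IsWeightedHomogeneous (intWt a b c) (X 1 ^ a - X 0 ^ b : MvPolynomial (Fin 3) K)
      (a * b : ℤ) := by
  refine IsWeightedHomogeneous.sub (isWeightedHomogeneous_X_pow 1 a) ?_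
  simpa [intWt, wt, mul_comm] using isWeightedHomogeneous_X_pow (K := K) (a := a) 0 b

lemma isWeightedHomogeneous_X_two_pow_sub :
    IsWeightedHomogeneous (intWt a b c) (X 2 ^ a - X 0 ^ c : MvPolynomial (Fin 3) K)
      (a * c : ℤ) := by
  refine IsWeightedHomogeneous.sub (isWeightedHomogeneous_X_pow 2 a) ?_
  simpa [intWt, wt, mul_comm] using isWeightedHomogeneous_X_pow (K := K) (a := a) 0 c

lemma mem_symbPow_one {f : MvPolynomial (Fin 3) K} (hf : f ∈ pIdeal K a b c) :
    f ∈ symbPow (pIdeal K a b c) 1 := by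
  rw [symbPow, pow_one]
  exact Ideal.mem_map_of_mem _ hf

lemma pow_mem_symbPow {f : MvPolynomial (Fin 3) K} {m : ℕ}
    (hf : f ∈ symbPow (pIdeal K a b c) m) (n : ℕ) : f ^ n ∈ symbPow (pIdeal K a b c) (m * n) := by
  induction n with
  | zero => simp [symbPow_zero]
  | succ n ih =>
    rw [pow_succ, mul_add_one]
    exact mul_mem_symbPow ih hf

lemma coeff_mem_symbPow {p : Polynomial (MvPolynomial (Fin 3) K)}
    (hp : p ∈ symbolicRees (pIdeal K a b c)) (n : ℕ) :
    p.coeff n ∈ symbPow (pIdeal K a b c) n := by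
  rw [symbolicRees] at hp
  induction hp using Algebra.adjoin_induction generalizing n with
  | mem x hx =>
    simp only [Set.mem_iUnion, Set.mem_image] at hx
    obtain ⟨m, f, hf, rfl⟩ := hx
    rw [Polynomial.coeff_C_mul_X_pow]
    split_ifs with h
    · rwa [h]
    · exact Ideal.zero_mem _
  | algebraMap r =>
    rw [Polynomial.algebraMap_apply, Algebra.algebraMap_self_apply, Polynomial.coeff_C]
    split_ifs with h
    · simp [h, symbPow_zero]
    · exact Ideal.zero_mem _
  | add x y _ _ hx hy => exact add_mem (hx n) (hy n)
  | mul x y _ _ hx hy =>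
    rw [Polynomial.coeff_mul]
    refine Ideal.sum_mem _ fun i hi => ?_
    rw [← Finset.HasAntidiagonal.mem_antidiagonal.mp hi]
    exact mul_mem_symbPow (hx _) (hy _)

lemma C_mul_X_pow_mem_symbolicRees {f : MvPolynomial (Fin 3) K} {n : ℕ}
    (hf : f ∈ symbPow (pIdeal K a b c) n) :
    Polynomial.C f * Polynomial.X ^ n ∈ symbolicRees (pIdeal K a b c) :=
  Algebra.subset_adjoin (Set.mem_iUnion.mpr ⟨n, f, hf, rfl⟩)

variable (ha : 0 < a) (hb : 0 < b) (hc : 0 < c) (hab : a.Coprime b)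

include ha hb hab in
lemma HasOrder.pow {g : MvPolynomial (Fin 3) K} {o : ℕ} (hg : HasOrder a b c g o) (n : ℕ) :
    HasOrder a b c (g ^ n) (o * n) := by
  induction n with
  | zero =>
    refine ⟨by simp [symbPow_zero], fun h => ?_⟩
    have := symbPow_le_pIdeal ha hb hab (by lia) h
    simp [pIdeal, RingHom.mem_ker] at this
  | succ n ih =>
    rw [pow_succ, mul_add_one]
    exact ih.mul ha hb hab hg

include ha hb hab in
lemma symbPow_le_of_homogeneous {n : ℕ} {J : Ideal (MvPolynomial (Fin 3) K)}
    (h : ∀ d : ℤ, ∀ f ∈ symbPiece K a b c n d, f ∈ J) : symbPow (pIdeal K a b c) n ≤ J := by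
  intro f hf
  rw [← finsum_weightedHomogeneousComponent (intWt a b c) f]
  exact finsum_induction (· ∈ J) J.zero_mem (fun _ _ => J.add_mem) fun d =>
    h d _ (mem_symbPiece.mpr ⟨weightedHomogeneousComponent_mem_symbPow ha hb hab hf d,
      weightedHomogeneousComponent_isWeightedHomogeneous _ _⟩)

variable {g₁ g₂ : MvPolynomial (Fin 3) K} {r d₁ d₂ : ℕ}
  (h₁ : HasOrder a b c g₁ r) (h₂ : HasOrder a b c g₂ r)
  (hd₁ : IsWeightedHomogeneous (intWt a b c) g₁ (d₁ : ℤ))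
  (hd₂ : IsWeightedHomogeneous (intWt a b c) g₂ (d₂ : ℤ))
  (hrel : IsRelPrime g₁ g₂) (heq : d₁ * d₂ = a * b * c * (r * r))

include ha hb hc hab h₁ h₂ hd₁ hd₂ hrel heq

lemma exists_mul_mem_span_pair {g f : MvPolynomial (Fin 3) K} {n e : ℕ} {d : ℤ} (hn : r + r ≤ n)
    (hf : f ∈ symbPiece K a b c n d) (he : 0 < e)
    (hg : IsWeightedHomogeneous (intWt a b c) g (e : ℤ)) :
    ∃ i : ℕ, ∃ u ∈ symbPow (pIdeal K a b c) (n - r), ∃ v ∈ symbPow (pIdeal K a b c) (n - r),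
      g ^ i * f = g₁ * u + g₂ * v := by
  obtain ⟨D, hD⟩ := exists_decomposition ha hb hc hab h₁ h₂ hd₁ hd₂ hrel heq hn
  set i := (D - d).toNat
  have hp : g ^ i * f ∈ symbPiece K a b c n (i * e + d) := by
    rw [mem_symbPiece] at hf ⊢
    refine ⟨Ideal.mul_mem_left _ _ hf.1, ?_⟩
    simpa using (hg.pow i).mul hf.2
  have hle : D ≤ i * e + d := by
    have h1 : (i : ℤ) ≤ i * e := le_mul_of_one_le_right (by lia) (by lia)
    lia
  obtain ⟨u, hu, v, hv, h⟩ := hD _ hle _ hp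
  exact ⟨i, u, (mem_symbPiece.mp hu).1, v, (mem_symbPiece.mp hv).1, h⟩

lemma isRelPrime_killX : IsRelPrime (killX K g₁) (killX K g₂) := by
  have key {i : Fin 3} {f : MvPolynomial (Fin 3) K} {d : ℤ}
      (hf : f ∈ symbPow (pIdeal K a b c) 1) (hd : IsWeightedHomogeneous (intWt a b c) f d)
      (hi : killX K (X i) = X i) (hfi : killX K f = X i ^ a) :
      ∃ k, ∀ q, q ∣ killX K g₁ → q ∣ killX K g₂ → q ∣ X i ^ k := by
    have hmem : f ^ (r + r) ∈ symbPiece K a b c (r + r) ((r + r : ℕ) * d) := by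
      refine mem_symbPiece.mpr ⟨by simpa using pow_mem_symbPow hf (r + r), ?_⟩
      simpa using hd.pow (r + r)
    have hpos : 0 < wt a b c i := by fin_cases i <;> assumption
    obtain ⟨j, u, -, v, -, huv⟩ := exists_mul_mem_span_pair ha hb hc hab h₁ h₂ hd₁ hd₂ hrel heq
      le_rfl hmem
      hpos (isWeightedHomogeneous_X K (intWt a b c) i)
    refine ⟨j + a * (r + r), fun q hq₁ hq₂ => ?_⟩
    have := congrArg (killX K) huv
    rw [map_mul, map_pow, map_pow, hi, hfi, ← pow_mul, ← pow_add] at this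
    rw [this, map_add, map_mul, map_mul]
    exact dvd_add (hq₁.mul_right _) (hq₂.mul_right _)
  obtain ⟨k, hk⟩ := key (i := 1) (mem_symbPow_one X_one_pow_sub_mem_pIdeal)
    isWeightedHomogeneous_X_one_pow_sub (by simp [killX]) (by simp [killX, hb.ne'])
  obtain ⟨l, hl⟩ := key (i := 2) (mem_symbPow_one X_two_pow_sub_mem_pIdeal)
    isWeightedHomogeneous_X_two_pow_sub (by simp [killX]) (by simp [killX, hc.ne'])
  intro q hq₁ hq₂
  have hX : IsRelPrime (X 1 : MvPolynomial (Fin 3) K) (X 2) :=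
    ((X_prime (i := 1)).irreducible.isRelPrime_iff_not_dvd).mpr (by simp [X_dvd_X])
  exact hX.pow (hk q hq₁ hq₂) (hl q hq₁ hq₂)

lemma symbPow_le_span_pair_pow (n : ℕ) :
    symbPow (pIdeal K a b c) (r * n + r) ≤ Ideal.span {g₁, g₂} ^ n := by
  have hx := mem_span_pair_of_X_mul_mem
    (isRelPrime_killX ha hb hc hab h₁ h₂ hd₁ hd₂ hrel heq)
  induction n with
  | zero => simp
  | succ n ih =>
    refine symbPow_le_of_homogeneous ha hb hab fun d f hf => ?_
    obtain ⟨j, u, hu, v, hv, huv⟩ := exists_mul_mem_span_pair ha hb hc hab h₁ h₂ hd₁ hd₂ hrel heq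
      (by rw [mul_add_one]; lia) hf ha (isWeightedHomogeneous_X K (intWt a b c) 0)
    have hsub : r * (n + 1) + r - r = r * n + r := by rw [mul_add_one]; lia
    rw [hsub] at hu hv
    have hmem : X 0 ^ j * f ∈ Ideal.span {g₁, g₂} ^ (n + 1) := by
      rw [huv, pow_succ']
      exact add_mem (Ideal.mul_mem_mul (Ideal.subset_span (by simp)) (ih hu))
        (Ideal.mul_mem_mul (Ideal.subset_span (by simp)) (ih hv))
    clear huv
    induction j with
    | zero => simpa using hmem
    | succ j ihj =>
      rw [pow_succ' (X 0), mul_assoc] at hmem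
      exact ihj (mem_span_pair_pow_of_mul_mem hrel hx _ hmem)

theorem isNoetherianRing_symbolicRees_of_eq_order (hr : 0 < r) :
    IsNoetherianRing (symbolicRees (pIdeal K a b c)) := by
  set R := symbolicRees (pIdeal K a b c)
  set y₁ : Polynomial (MvPolynomial (Fin 3) K) := Polynomial.C g₁ * Polynomial.X ^ r with hy₁
  set y₂ : Polynomial (MvPolynomial (Fin 3) K) := Polynomial.C g₂ * Polynomial.X ^ r with hy₂
  set B := Algebra.adjoin (MvPolynomial (Fin 3) K) {y₁, y₂} with hB
  have hBR : B ≤ R := by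
    refine Algebra.adjoin_le ?_
    rintro _ (rfl | rfl)
    exacts [C_mul_X_pow_mem_symbolicRees h₁.1, C_mul_X_pow_mem_symbolicRees h₂.1]
  have hBnoeth : IsNoetherianRing B :=
    isNoetherianRing_of_fg (Subalgebra.fg_def.mpr ⟨_, Set.toFinite _, rfl⟩)
  let N : Submodule B (Polynomial (MvPolynomial (Fin 3) K)) :=
    Submodule.span B ((fun j => Polynomial.X ^ j) '' Set.Iio (2 * r))
  have hX {j : ℕ} (hj : j < 2 * r) {p : Polynomial (MvPolynomial (Fin 3) K)} (hp : p ∈ B) :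
      p * Polynomial.X ^ j ∈ N :=
    N.smul_mem ⟨p, hp⟩ (Submodule.subset_span ⟨j, hj, rfl⟩)
  have hC (p : MvPolynomial (Fin 3) K) : Polynomial.C p ∈ B := B.algebraMap_mem p
  have hmem {f : MvPolynomial (Fin 3) K} {m : ℕ} (hf : f ∈ symbPow (pIdeal K a b c) m) :
      Polynomial.C f * Polynomial.X ^ m ∈ N := by
    obtain hm | hm := lt_or_ge m (2 * r)
    · exact hX hm (hC f)
    obtain ⟨n, s, hs, rfl⟩ : ∃ n s, s < r ∧ m = r * n + r + s := by
      refine ⟨m / r - 1, m % r, Nat.mod_lt _ hr, ?_⟩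
      have h1 : 1 ≤ m / r := (Nat.one_le_div_iff hr).mpr (by lia)
      rw [← mul_add_one, Nat.sub_add_cancel h1, Nat.div_add_mod]
    have hI := symbPow_le_span_pair_pow ha hb hc hab h₁ h₂ hd₁ hd₂ hrel heq n
      (symbPow_anti (Nat.le_add_right _ s) hf)
    rw [← Ideal.mul_top (_ ^ n)] at hI
    obtain ⟨e, -, rfl⟩ := exists_sum_eq_of_mem_pow_mul n ⊤ hI
    rw [map_sum, Finset.sum_mul]
    refine N.sum_mem fun i hi => ?_
    have hi : i + (n - i) = n :=
      Nat.add_sub_of_le (Nat.lt_succ_iff.mp (Finset.mem_range.mp hi))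
    have hsplit : Polynomial.C (e i * (g₁ ^ i * g₂ ^ (n - i))) * Polynomial.X ^ (r * n + r + s) =
        (Polynomial.C (e i) * (y₁ ^ i * y₂ ^ (n - i))) * Polynomial.X ^ (r + s) := by
      have hp : (Polynomial.X ^ (r * n) : Polynomial (MvPolynomial (Fin 3) K)) =
          Polynomial.X ^ (r * i) * Polynomial.X ^ (r * (n - i)) := by
        rw [← pow_add, ← mul_add, hi]
      rw [add_assoc, pow_add, hp, hy₁, hy₂]
      simp only [mul_pow, map_mul, map_pow, ← pow_mul]
      ring
    rw [hsplit]
    exact hX (by lia) (B.mul_mem (hC _) (B.mul_mem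
      (B.pow_mem (Algebra.subset_adjoin (by simp)) _)
      (B.pow_mem (Algebra.subset_adjoin (by simp)) _)))
  have hRN (p : R) : (p : Polynomial (MvPolynomial (Fin 3) K)) ∈ N := by
    rw [Polynomial.as_sum_range_C_mul_X_pow p.1]
    exact N.sum_mem fun i _ => hmem (coeff_mem_symbPow p.2 i)
  let := (Subalgebra.inclusion hBR).toRingHom.toAlgebra
  have hN : IsNoetherian B N :=
    isNoetherian_span_of_finite B ((Set.finite_Iio _).image _)
  let φ : R →ₗ[B] N :=
    { toFun := fun p => ⟨p, hRN p⟩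
      map_add' := fun _ _ => rfl
      map_smul' := fun _ _ => rfl }
  have : IsNoetherian B R := isNoetherian_of_injective φ fun p q h =>
    Subtype.ext (congrArg (fun t : N => (t : Polynomial (MvPolynomial (Fin 3) K))) h)
  exact isNoetherian_of_tower B this

omit h₁ h₂ hd₁ hd₂ hrel heq

theorem isNoetherianRing_symbolicRees {r₁ r₂ : ℕ} (hr₁ : 0 < r₁) (hr₂ : 0 < r₂)
    (hg₁ : g₁ ∈ symbPow (pIdeal K a b c) r₁) (hg₂ : g₂ ∈ symbPow (pIdeal K a b c) r₂)
    (hd₁ : IsWeightedHomogeneous (intWt a b c) g₁ (d₁ : ℤ))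
    (hd₂ : IsWeightedHomogeneous (intWt a b c) g₂ (d₂ : ℤ))
    (hg₁0 : g₁ ≠ 0) (hg₂0 : g₂ ≠ 0) (hrel : IsRelPrime g₁ g₂)
    (heq : d₁ * d₂ = a * b * c * (r₁ * r₂)) :
    IsNoetherianRing (symbolicRees (pIdeal K a b c)) := by
  obtain ⟨o₁, h₁⟩ := exists_hasOrder ha hb hab hg₁0
  obtain ⟨o₂, h₂⟩ := exists_hasOrder ha hb hab hg₂0
  have hle₁ := h₁.le_of_mem hg₁
  have hle₂ := h₂.le_of_mem hg₂
  have hle : o₁ * o₂ ≤ r₁ * r₂ := by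
    refine Nat.le_of_mul_le_mul_left (heq ▸ ?_) (show 0 < a * b * c by positivity)
    exact mul_orders_le ha hb hc hab h₁ h₂ hd₁ hd₂ hrel
  obtain rfl : r₁ = o₁ := by
    refine le_antisymm hle₁ (Nat.le_of_mul_le_mul_right ?_ hr₂)
    exact (Nat.mul_le_mul_left _ hle₂).trans hle
  obtain rfl : r₂ = o₂ := le_antisymm hle₂ (Nat.le_of_mul_le_mul_left hle hr₁)
  refine isNoetherianRing_symbolicRees_of_eq_order (d₁ := r₂ * d₁) (d₂ := r₁ * d₂) ha hb hc hab
    (h₁.pow ha hb hab r₂) (mul_comm r₁ r₂ ▸ h₂.pow ha hb hab r₁) ?_ ?_ hrel.pow ?_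
    (mul_pos hr₁ hr₂)
  · simpa using hd₁.pow r₂
  · simpa using hd₂.pow r₁
  · rw [mul_mul_mul_comm, heq]
    ring

end Huneke

section RegularPair

variable {R : Type*} [CommRing R] [IsDomain R] {g₁ g₂ : R}

lemma isRegular_pair_iff : RingTheory.Sequence.IsRegular R [g₁, g₂] ↔
    g₁ ≠ 0 ∧ (∀ x, g₁ ∣ g₂ * x → g₁ ∣ x) ∧ Ideal.span {g₁, g₂} ≠ ⊤ := by
  rw [RingTheory.Sequence.isRegular_iff, RingTheory.Sequence.isWeaklyRegular_cons_iff,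
    RingTheory.Sequence.isWeaklyRegular_singleton_iff, and_assoc]
  refine and_congr ⟨fun h => ?_, IsSMulRegular.of_ne_zero⟩ (and_congr ?_ ?_)
  · rintro rfl
    exact one_ne_zero (h (by simp : (0 : R) • (1 : R) = (0 : R) • (0 : R)))
  · rw [isSMulRegular_quotient_iff_mem_of_smul_mem]
    simp only [← Submodule.ideal_span_singleton_smul, smul_eq_mul, Ideal.mul_top,
      Ideal.mem_span_singleton]
  · rw [Ideal.ofList_cons, Ideal.ofList_singleton, smul_eq_mul, Ideal.mul_top, ← Ideal.span_union,
      Set.singleton_union, ne_comm]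

lemma isRelPrime_of_isRegular (h : RingTheory.Sequence.IsRegular R [g₁, g₂]) :
    g₁ ≠ 0 ∧ g₂ ≠ 0 ∧ IsRelPrime g₁ g₂ := by
  obtain ⟨h0, h1, h2⟩ := isRegular_pair_iff.mp h
  refine ⟨h0, ?_, ?_⟩
  · rintro rfl
    refine h2 (Ideal.eq_top_of_isUnit_mem _ (Ideal.subset_span (Set.mem_insert g₁ _)) ?_)
    exact isUnit_of_dvd_one (h1 1 (by simp))
  · rintro q ⟨u, rfl⟩ ⟨v, rfl⟩
    obtain ⟨w, hw⟩ := h1 u ⟨v, by ring⟩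
    have hu : u ≠ 0 := right_ne_zero_of_mul h0
    refine IsUnit.of_mul_eq_one w (mul_right_cancel₀ hu ?_)
    linear_combination -hw

end RegularPair

section HomogeneousFactors

variable {R σ : Type*} [CommRing R]

/-- The map `Xᵢ ↦ Xᵢ T ^ wᵢ` recording weighted homogeneous components. -/
noncomputable def gradingMap (w : σ → ℕ) :
    MvPolynomial σ R →ₐ[R] Polynomial (MvPolynomial σ R) :=
  aeval fun i => Polynomial.C (X i) * Polynomial.X ^ w i

lemma gradingMap_monomial (w : σ → ℕ) (m : σ →₀ ℕ) (r : R) :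
    gradingMap w (monomial m r) = Polynomial.monomial (Finsupp.weight w m) (monomial m r) := by
  rw [gradingMap, aeval_monomial, Finsupp.prod]
  simp only [mul_pow, Finset.prod_mul_distrib, ← map_pow, ← map_prod, ← pow_mul,
    Finset.prod_pow_eq_pow_sum]
  rw [← Polynomial.C_mul_X_pow_eq_monomial, monomial_eq, Finsupp.prod, Finsupp.weight_apply,
    Finsupp.sum, map_mul, mul_assoc]
  simp only [smul_eq_mul, mul_comm]
  rfl

lemma coeff_gradingMap (w : σ → ℕ) (f : MvPolynomial σ R) (n : ℕ) :
    (gradingMap w f).coeff n = weightedHomogeneousComponent w n f := by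
  classical
  induction f using MvPolynomial.induction_on' with
  | add f₁ f₂ h₁ h₂ => rw [map_add, Polynomial.coeff_add, h₁, h₂, map_add]
  | monomial m r =>
    rw [gradingMap_monomial, Polynomial.coeff_monomial,
      weightedHomogeneousComponent_of_mem (isWeightedHomogeneous_monomial w m r rfl)]
    simp only [eq_comm]

lemma gradingMap_of_isWeightedHomogeneous {w : σ → ℕ} {f : MvPolynomial σ R} {n : ℕ}
    (hf : IsWeightedHomogeneous w f n) : gradingMap w f = Polynomial.monomial n f := by
  ext1 m
  rw [coeff_gradingMap, Polynomial.coeff_monomial]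
  split_ifs with h
  · rw [← h, hf.weightedHomogeneousComponent_same]
  · exact hf.weightedHomogeneousComponent_ne _ (Ne.symm h)

lemma gradingMap_ne_zero {w : σ → ℕ} {f : MvPolynomial σ R} (hf : f ≠ 0) :
    gradingMap w f ≠ 0 := by
  intro h
  refine hf ?_
  rw [← finsum_weightedHomogeneousComponent w f]
  simp [← coeff_gradingMap, h]

lemma exists_isWeightedHomogeneous_of_mul [IsDomain R] {w : σ → ℕ} {f g : MvPolynomial σ R}
    {n : ℕ} (hfg : IsWeightedHomogeneous w (f * g) n) (h0 : f * g ≠ 0) :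
    ∃ m, IsWeightedHomogeneous w f m := by
  have hf := gradingMap_ne_zero (w := w) (left_ne_zero_of_mul h0)
  have hg := gradingMap_ne_zero (w := w) (right_ne_zero_of_mul h0)
  have h := gradingMap_of_isWeightedHomogeneous hfg
  rw [map_mul] at h
  have h1 := congrArg Polynomial.natDegree h
  have h2 := congrArg Polynomial.natTrailingDegree h
  rw [Polynomial.natDegree_mul hf hg, Polynomial.natDegree_monomial_eq _ h0] at h1
  rw [Polynomial.natTrailingDegree_mul hf hg, Polynomial.natTrailingDegree_monomial h0] at h2
  have h3 := Polynomial.natTrailingDegree_le_natDegree (gradingMap w f)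
  have h4 := Polynomial.natTrailingDegree_le_natDegree (gradingMap w g)
  refine ⟨(gradingMap w f).natDegree, ?_⟩
  have key (m : ℕ) (hm : m ≠ (gradingMap w f).natDegree) :
      weightedHomogeneousComponent w m f = 0 := by
    rw [← coeff_gradingMap]
    obtain hm | hm := lt_or_gt_of_ne hm
    · exact Polynomial.coeff_eq_zero_of_lt_natTrailingDegree (by lia)
    · exact Polynomial.coeff_eq_zero_of_natDegree_lt hm
  generalize (gradingMap w f).natDegree = N at key
  rw [← finsum_weightedHomogeneousComponent w f, finsum_eq_single _ _ key]
  exact weightedHomogeneousComponent_isWeightedHomogeneous _ _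

end HomogeneousFactors

section MinimalSlope

variable {K : Type*} [Field K] {a b c : ℕ}

variable (ha : 0 < a) (hb : 0 < b) (hc : 0 < c) (hab : a.Coprime b)

include ha hb hab in
lemma exists_generators (h : IsNoetherianRing (symbolicRees (pIdeal K a b c))) :
    ∃ s : Finset (ℕ × ℤ × MvPolynomial (Fin 3) K),
      (∀ t ∈ s, 0 < t.1 ∧ t.2.2 ∈ symbPiece K a b c t.1 t.2.1) ∧
      ∀ (q : Ideal (MvPolynomial (Fin 3) K)) (n : ℕ) (d : ℤ), 0 < n →
        ∀ f ∈ symbPiece K a b c n d, f ∉ q →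
          ∃ t ∈ s, t.1 ≤ n ∧ t.2.2 ∉ q ∧
            ∃ u ∈ symbPiece K a b c (n - t.1) (d - t.2.1), u ∉ q := by
  classical
  let ι := {t : ℕ × ℤ × MvPolynomial (Fin 3) K // 0 < t.1 ∧ t.2.2 ∈ symbPiece K a b c t.1 t.2.1}
  let φ : ι → symbolicRees (pIdeal K a b c) := fun t =>
    ⟨_, C_mul_X_pow_mem_symbolicRees (mem_symbPiece.mp t.2.2).1⟩
  obtain ⟨T, hT, hspan⟩ := (Submodule.fg_span_iff_fg_span_finset_subset (Set.range φ)).mp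
    (IsNoetherian.noetherian (Submodule.span (symbolicRees (pIdeal K a b c)) (Set.range φ)))
  rw [← Set.image_univ] at hT
  obtain ⟨s, -, rfl⟩ := Finset.subset_set_image_iff.mp hT
  refine ⟨s.map (Function.Embedding.subtype _), ?_, fun q n d hn f hf hfq => ?_⟩
  · intro t ht
    obtain ⟨t, -, rfl⟩ := Finset.mem_map.mp ht
    exact t.2
  · have hmem : φ ⟨(n, d, f), hn, hf⟩ ∈
        Submodule.span (symbolicRees (pIdeal K a b c)) (Set.range φ) :=
      Submodule.subset_span ⟨_, rfl⟩
    rw [hspan, Finset.coe_image, Submodule.mem_span_image_finset_iff_exists_fun'] at hmem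
    obtain ⟨p, hp⟩ := hmem
    by_contra! hcon
    have hp' := congrArg (fun z : symbolicRees (pIdeal K a b c) =>
      weightedHomogeneousComponent (intWt a b c) d (z.1.coeff n)) hp
    simp only [AddSubmonoidClass.coe_finsetSum, Polynomial.finsetSum_coeff, map_sum, φ,
      Polynomial.coeff_C_mul_X_pow, if_true,
      (mem_symbPiece.mp hf).2.weightedHomogeneousComponent_same] at hp'
    refine hfq (hp' ▸ q.sum_mem fun t ht => ?_)
    have hcoeff := coeff_mem_symbPow (p t).2 (n - t.1.1)
    obtain ⟨⟨m, e, g⟩, hm, hg⟩ := t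
    simp only at hcoeff hm hg
    rw [smul_eq_mul, MulMemClass.coe_mul, ← mul_assoc, Polynomial.coeff_mul_X_pow']
    split_ifs with hmn
    · rw [Polynomial.coeff_mul_C, mul_comm,
        weightedHomogeneousComponent_mul (mem_symbPiece.mp hg).2]
      by_cases hgq : g ∈ q
      · exact Ideal.mul_mem_right _ _ hgq
      · refine Ideal.mul_mem_left _ _ ?_
        exact hcon (m, e, g) (Finset.mem_map.mpr ⟨_, ht, rfl⟩) hmn hgq _
          (mem_symbPiece.mpr ⟨weightedHomogeneousComponent_mem_symbPow ha hb hab hcoeff _,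
            weightedHomogeneousComponent_isWeightedHomogeneous _ _⟩)
    · simp

lemma nonneg_of_mem_symbPiece {n : ℕ} {d : ℤ} {f : MvPolynomial (Fin 3) K}
    (hf : f ∈ symbPiece K a b c n d) (h0 : f ≠ 0) : 0 ≤ d := by
  by_contra! hd
  exact h0 (eq_zero_of_isWeightedHomogeneous_neg (mem_symbPiece.mp hf).2 hd)

include ha hb hab in
lemma exists_minimal_slope (h : IsNoetherianRing (symbolicRees (pIdeal K a b c)))
    (q : Ideal (MvPolynomial (Fin 3) K))
    (hq : ∃ n d, 0 < n ∧ ∃ f ∈ symbPiece K a b c n d, f ∉ q) :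
    ∃ n₀ d₀, 0 < n₀ ∧ (∃ g ∈ symbPiece K a b c n₀ d₀, g ∉ q) ∧
      ∀ n d, ∀ f ∈ symbPiece K a b c n d, f ∉ q → d₀ * n ≤ d * n₀ := by
  classical
  obtain ⟨s, hs, hgen⟩ := exists_generators ha hb hab h
  obtain ⟨n, d, hn, f, hf, hfq⟩ := hq
  obtain ⟨t, ht, -, htq, -⟩ := hgen q n d hn f hf hfq
  obtain ⟨t₀, ht₀, hmin⟩ := (s.filter fun t => t.2.2 ∉ q).exists_min_image
    (fun t => (t.2.1 / t.1 : ℚ)) ⟨t, by simp [ht, htq]⟩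
  obtain ⟨ht₀s, ht₀q⟩ := Finset.mem_filter.mp ht₀
  refine ⟨t₀.1, t₀.2.1, (hs _ ht₀s).1, ⟨_, (hs _ ht₀s).2, ht₀q⟩, fun n => ?_⟩
  clear! n d f t
  induction n using Nat.strong_induction_on with
  | _ n ih =>
    intro d f hf hfq
    obtain rfl | hn := n.eq_zero_or_pos
    · have := nonneg_of_mem_symbPiece hf fun h => hfq (h ▸ q.zero_mem)
      simpa using mul_nonneg this (Nat.cast_nonneg _)
    obtain ⟨t, ht, htn, htq, u, hu, huq⟩ := hgen q n d hn f hf hfq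
    have ht0 := (hs t ht).1
    have h1 := ih (n - t.1) (by lia) _ u hu huq
    have h2 := hmin t (Finset.mem_filter.mpr ⟨ht, htq⟩)
    rw [div_le_div_iff₀ (by exact_mod_cast (hs _ ht₀s).1) (by exact_mod_cast ht0)] at h2
    norm_cast at h2
    rw [Nat.cast_sub htn] at h1
    linarith

include ha hb hc in
lemma eq_C_of_isWeightedHomogeneous_zero {f : MvPolynomial (Fin 3) K}
    (hf : IsWeightedHomogeneous (intWt a b c) f 0) : f = C (constantCoeff f) := by
  ext m
  rw [coeff_C]
  split_ifs with h
  · rw [← h, constantCoeff_eq]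
  · refine hf.coeff_eq_zero m fun h0 => h ?_
    rw [weight_intWt, Nat.cast_eq_zero, Finsupp.weight_apply, Finsupp.sum_fintype _ _ (by simp),
      Fin.sum_univ_three] at h0
    simp [wt, ha.ne', hb.ne', hc.ne'] at h0
    ext i
    fin_cases i <;> simp [h0]

include ha hb hc in
lemma isUnit_of_isWeightedHomogeneous_zero {f : MvPolynomial (Fin 3) K}
    (hf : IsWeightedHomogeneous (intWt a b c) f 0) (h0 : f ≠ 0) : IsUnit f := by
  have hC := eq_C_of_isWeightedHomogeneous_zero ha hb hc hf
  rw [hC] at h0 ⊢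
  exact (isUnit_iff_ne_zero.mpr fun h => h0 (by rw [h, C_0])).map C

include ha hb hc hab in
lemma pos_of_mem_symbPiece {n : ℕ} {d : ℤ} {f : MvPolynomial (Fin 3) K}
    (hf : f ∈ symbPiece K a b c n d) (h0 : f ≠ 0) (hn : 0 < n) : 0 < d := by
  refine (nonneg_of_mem_symbPiece hf h0).lt_of_ne' ?_
  rintro rfl
  obtain ⟨hf, hf'⟩ := mem_symbPiece.mp hf
  have hP := symbPow_le_pIdeal ha hb hab hn hf
  have hC := eq_C_of_isWeightedHomogeneous_zero ha hb hc hf'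
  rw [hC, pIdeal, RingHom.mem_ker] at hP
  simp [toPoly] at hP
  exact h0 (by rw [hC, hP, C_0])

include ha hb hc hab in
lemma exists_irreducible_minimal_slope (h : IsNoetherianRing (symbolicRees (pIdeal K a b c))) :
    ∃ (r d : ℕ) (g : MvPolynomial (Fin 3) K), 0 < r ∧ 0 < d ∧ Irreducible g ∧
      IsWeightedHomogeneous (intWt a b c) g (d : ℤ) ∧ HasOrder a b c g r ∧
      ∀ (n : ℕ) (e : ℤ), ∀ f ∈ symbPiece K a b c n e, f ≠ 0 → (d : ℤ) * n ≤ e * r := by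
  classical
  obtain ⟨n₀, d₀, hn₀, hex, hmin⟩ := exists_minimal_slope ha hb hab h ⊥
    ⟨1, a * b, one_pos, X 1 ^ a - X 0 ^ b, mem_symbPiece.mpr
      ⟨mem_symbPow_one X_one_pow_sub_mem_pIdeal, isWeightedHomogeneous_X_one_pow_sub⟩, by
        rw [Ideal.mem_bot, sub_eq_zero]
        intro h
        simpa [ha.ne', hb.ne'] using congrArg (eval ![0, 1, 0]) h⟩
  simp only [Ideal.mem_bot] at hex hmin
  have hP : ∃ d : ℕ, ∃ n : ℕ, 0 < n ∧ d * n₀ = d₀ * n ∧ ∃ g ∈ symbPiece K a b c n d, g ≠ 0 := by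
    obtain ⟨g, hg, hg0⟩ := hex
    have := nonneg_of_mem_symbPiece hg hg0
    lift d₀ to ℕ using this
    exact ⟨d₀, n₀, hn₀, rfl, g, hg, hg0⟩
  have hdmin := fun m => Nat.find_min' hP (m := m)
  obtain ⟨r, hr, hslope, g, hg, hg0⟩ := Nat.find_spec hP
  set d := Nat.find hP
  have hmin' (n : ℕ) (e : ℤ) (f) (hf : f ∈ symbPiece K a b c n e) (hf0 : f ≠ 0) :
      (d : ℤ) * n ≤ e * r := by
    have h1 := hmin n e f hf hf0
    have h2 : (d : ℤ) * n * n₀ ≤ e * r * n₀ := by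
      calc (d : ℤ) * n * n₀ = d * n₀ * n := by ring
        _ = d₀ * n * r := by rw [hslope]; ring
        _ ≤ e * n₀ * r := by gcongr
        _ = e * r * n₀ := by ring
    exact le_of_mul_le_mul_right h2 (by exact_mod_cast hn₀)
  have hd := pos_of_mem_symbPiece ha hb hc hab hg hg0 hr
  obtain ⟨hgs, hgd⟩ := mem_symbPiece.mp hg
  obtain ⟨o, ho⟩ := exists_hasOrder ha hb hab hg0
  obtain rfl : o = r := by
    refine le_antisymm ?_ (ho.le_of_mem hgs)
    have := hmin' o d g (mem_symbPiece.mpr ⟨ho.1, hgd⟩) hg0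
    exact_mod_cast le_of_mul_le_mul_left this hd
  refine ⟨o, d, g, hr, by exact_mod_cast hd, ⟨fun hu => ?_, fun u v huv => ?_⟩, hgd, ho, hmin'⟩
  · exact (pIdeal_isPrime K a b c).ne_top
      (Ideal.eq_top_of_isUnit_mem _ (symbPow_le_pIdeal ha hb hab hr hgs) hu)
  · subst huv
    have hu0 := left_ne_zero_of_mul hg0
    have hv0 := right_ne_zero_of_mul hg0
    have hgd' := isWeightedHomogeneous_intWt.mp hgd
    obtain ⟨e₁, hu⟩ := exists_isWeightedHomogeneous_of_mul hgd' hg0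
    obtain ⟨e₂, hv⟩ := exists_isWeightedHomogeneous_of_mul (mul_comm u v ▸ hgd')
      (mul_comm u v ▸ hg0)
    have hd' : e₁ + e₂ = d := (hu.mul hv).inj_right hg0 hgd'
    rw [← isWeightedHomogeneous_intWt] at hu hv
    obtain ⟨o₁, h₁⟩ := exists_hasOrder ha hb hab hu0
    obtain ⟨o₂, h₂⟩ := exists_hasOrder ha hb hab hv0
    have ho' : o₁ + o₂ = o :=
      le_antisymm (ho.le_of_mem (h₁.mul ha hb hab h₂).1) ((h₁.mul ha hb hab h₂).le_of_mem hgs)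
    have hmem₁ := mem_symbPiece.mpr ⟨h₁.1, hu⟩
    have hmem₂ := mem_symbPiece.mpr ⟨h₂.1, hv⟩
    have hs₁ : d * o₁ ≤ e₁ * o := by exact_mod_cast hmin' o₁ e₁ u hmem₁ hu0
    have hs₂ : d * o₂ ≤ e₂ * o := by exact_mod_cast hmin' o₂ e₂ v hmem₂ hv0
    obtain rfl | ho₁ := o₁.eq_zero_or_pos
    · rw [← ho', zero_add] at hs₂
      have := Nat.le_of_mul_le_mul_right hs₂ (by lia)
      obtain rfl : e₁ = 0 := by lia
      exact Or.inl (isUnit_of_isWeightedHomogeneous_zero ha hb hc (by simpa using hu) hu0)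
    obtain rfl | ho₂ := o₂.eq_zero_or_pos
    · rw [← ho', add_zero] at hs₁
      have := Nat.le_of_mul_le_mul_right hs₁ (by lia)
      obtain rfl : e₂ = 0 := by lia
      exact Or.inr (isUnit_of_isWeightedHomogeneous_zero ha hb hc (by simpa using hv) hv0)
    exfalso
    have he₂ := pos_of_mem_symbPiece ha hb hc hab hmem₂ hv0 ho₂
    have hs : d * o₁ = e₁ * o := by
      have h3 : d * o₁ + d * o₂ = e₁ * o + e₂ * o := by rw [← mul_add, ← add_mul, hd', ho']
      lia
    have hslope' : (e₁ : ℤ) * n₀ = d₀ * o₁ := by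
      refine mul_right_cancel₀ (b := (o : ℤ)) (by exact_mod_cast hr.ne') ?_
      have hs' : (d : ℤ) * o₁ = e₁ * o := by exact_mod_cast hs
      linear_combination (o₁ : ℤ) * hslope - (n₀ : ℤ) * hs'
    have := hdmin e₁ ⟨o₁, ho₁, hslope', u, hmem₁, hu0⟩
    lia

lemma not_dvd_and_dvd {g : MvPolynomial (Fin 3) K} {d : ℤ} (hd : d ≠ 0)
    (hg : IsWeightedHomogeneous (intWt a b c) g d) (hb : 0 < b) (hc : 0 < c)
    (h₁ : g ∣ X 1 ^ a - X 0 ^ b) (h₂ : g ∣ X 2 ^ a - X 0 ^ c) : False := by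
  have h₁ := map_dvd (killX K) h₁
  have h₂ := map_dvd (killX K) h₂
  simp only [killX, map_sub, map_pow, aeval_X, Matrix.cons_val, zero_pow hb.ne', zero_pow hc.ne',
    sub_zero] at h₁ h₂
  have hX : IsRelPrime (X 1 : MvPolynomial (Fin 3) K) (X 2) :=
    ((X_prime (i := 1)).irreducible.isRelPrime_iff_not_dvd).mpr (by simp [X_dvd_X])
  have hu : IsUnit (killX K g) := hX.pow h₁ h₂
  obtain ⟨f, hf⟩ := X_dvd_sub_killX g
  have h0 := congrArg constantCoeff hf
  have hg0 : constantCoeff g = 0 := hg.coeff_eq_zero 0 (by simpa using hd.symm)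
  rw [map_sub, map_mul, constantCoeff_X, zero_mul, hg0, zero_sub, neg_eq_zero] at h0
  have := hu.map (constantCoeff (R := K))
  rw [h0] at this
  exact not_isUnit_zero this

end MinimalSlope

section Counting

variable {K : Type*} [Field K] {a b c : ℕ}

lemma sum_Ico_sub_eq (u : ℤ → ℤ) (m n s : ℤ) :
    ∑ d ∈ Finset.Ico m n, u (d - s) = ∑ d ∈ Finset.Ico (m - s) (n - s), u d := by
  simpa [sub_eq_add_neg] using Finset.sum_Ico_add' u m n (-s)

lemma sum_Ico_sub_le {u : ℤ → ℤ} (hu : ∀ d, 0 ≤ u d) (hneg : ∀ d < 0, u d = 0) (M : ℤ) {s : ℤ}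
    (hs : 0 ≤ s) : ∑ d ∈ Finset.Ico 0 M, u (d - s) ≤ ∑ d ∈ Finset.Ico 0 M, u d := by
  rw [sum_Ico_sub_eq]
  calc ∑ d ∈ Finset.Ico (0 - s) (M - s), u d
      ≤ ∑ d ∈ Finset.Ico (0 - s) M, u d :=
        Finset.sum_le_sum_of_subset_of_nonneg (Finset.Ico_subset_Ico_right (by lia))
          fun d _ _ => hu d
    _ = ∑ d ∈ Finset.Ico 0 M, u d := by
        refine (Finset.sum_subset (Finset.Ico_subset_Ico_left (by lia)) fun d hd hd' => ?_).symm
        simp only [Finset.mem_Ico] at hd hd'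
        exact hneg d (by lia)

lemma sum_Ico_sub_sub_le {u : ℤ → ℤ} (hu : ∀ d, 0 ≤ u d) {T : ℤ} (hT : ∀ d, u d ≤ T) {M : ℤ}
    (hM : 0 ≤ M) (s : ℕ) : ∑ d ∈ Finset.Ico 0 M, (u d - u (d - s)) ≤ s * T := by
  rw [Finset.sum_sub_distrib, sum_Ico_sub_eq, sub_le_iff_le_add']
  have hdisj : Disjoint (Finset.Ico (0 - s : ℤ) (M - s)) (Finset.Ico (M - s) M) :=
    Finset.Ico_disjoint_Ico_consecutive _ _ _
  calc ∑ d ∈ Finset.Ico 0 M, u d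
      ≤ ∑ d ∈ Finset.Ico (0 - s : ℤ) (M - s) ∪ Finset.Ico (M - s) M, u d := by
        rw [Finset.Ico_union_Ico_eq_Ico (by lia) (by lia)]
        exact Finset.sum_le_sum_of_subset_of_nonneg (Finset.Ico_subset_Ico_left (by lia))
          fun d _ _ => hu d
    _ = ∑ d ∈ Finset.Ico (0 - s : ℤ) (M - s), u d + ∑ d ∈ Finset.Ico (M - s) M, u d :=
        Finset.sum_union hdisj
    _ ≤ ∑ d ∈ Finset.Ico (0 - s : ℤ) (M - s), u d + s * T := by
        gcongr
        simpa using Finset.sum_le_card_nsmul (Finset.Ico (M - s) M) u T fun d _ => hT d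

variable (ha : 0 < a) (hb : 0 < b) (hc : 0 < c) (hab : a.Coprime b)

variable (K a b c) in
/-- The growth in degree `d` of the quotient by the `n`-th symbolic power under multiplication
by `x`. -/
noncomputable def codimGrowth (n : ℕ) (d : ℤ) : ℤ :=
  (symbDim K a b c 0 d - symbDim K a b c n d) -
    (symbDim K a b c 0 (d - a) - symbDim K a b c n (d - a))

include ha hb hc hab in
lemma codimGrowth_nonneg (n : ℕ) (d : ℤ) : 0 ≤ codimGrowth K a b c n d := by
  have hX : IsWeightedHomogeneous (intWt a b c) (X 0 : MvPolynomial (Fin 3) K) (a : ℤ) :=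
    isWeightedHomogeneous_X K (intWt a b c) 0
  have hord := hasOrder_X (K := K) (c := c) ha hb hab 0
  have := finite_symbPiece (K := K) ha hb hc 0 d
  have := finite_symbPiece (K := K) ha hb hc n d
  have := finite_symbPiece (K := K) ha hb hc 0 (d - a)
  set V := mulImage (X 0) (symbPiece K a b c 0 (d - a))
  have : Module.Finite K V := Module.Finite.map _ _
  have hinf : symbPiece K a b c n d ⊓ V = mulImage (X 0) (symbPiece K a b c n (d - a)) := by
    ext f
    rw [Submodule.mem_inf, mem_mulImage, mem_mulImage]
    constructor
    · rintro ⟨hf, u, -, rfl⟩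
      exact ⟨u, (hord.mul_mem_symbPiece_iff ha hb hab hX).mp hf, rfl⟩
    · rintro ⟨u, hu, rfl⟩
      exact ⟨(hord.mul_mem_symbPiece_iff ha hb hab hX).mpr hu, u,
        symbPiece_anti (Nat.zero_le n) _ hu, rfl⟩
  have hsup : symbPiece K a b c n d ⊔ V ≤ symbPiece K a b c 0 d := by
    refine sup_le (symbPiece_anti (Nat.zero_le n) d) ?_
    rintro _ ⟨u, hu, rfl⟩
    exact (hord.mul_mem_symbPiece_iff ha hb hab hX).mpr hu
  have h1 := Submodule.finrank_sup_add_finrank_inf_eq (symbPiece K a b c n d) V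
  rw [hinf, finrank_mulImage (X_ne_zero 0), finrank_mulImage (X_ne_zero 0)] at h1
  have h2 := Submodule.finrank_mono hsup
  rw [codimGrowth, symbDim, symbDim, symbDim, symbDim]
  lia

include ha hb hc hab in
lemma sum_codimGrowth_le (n : ℕ) {M : ℤ} (hM : 0 ≤ M) :
    2 * ∑ d ∈ Finset.Ico 0 M, codimGrowth K a b c n d ≤ a * (n * (n + 1)) := by
  have h1 (d : ℤ) := symbDim_mono (K := K) ha hb hc (Nat.zero_le n) d
  have h2 (d : ℤ) := symbDim_zero_le (K := K) ha hb hc hab n d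
  rw [Finset.mul_sum]
  have := sum_Ico_sub_sub_le
    (u := fun d => 2 * (symbDim K a b c 0 d - symbDim K a b c n d)) (T := n * (n + 1))
    (fun d => by linarith [h1 d]) (fun d => by linarith [h2 d]) hM a
  refine le_trans (le_of_eq (Finset.sum_congr rfl fun d _ => ?_)) this
  rw [codimGrowth]
  ring

variable (K a b c) in
/-- The second difference, with steps `a` and `e`, of the Hilbert function of the polynomial
ring. -/
noncomputable def secondDiff (e : ℤ) (d : ℤ) : ℤ :=
  symbDim K a b c 0 d - symbDim K a b c 0 (d - a) - symbDim K a b c 0 (d - e) +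
    symbDim K a b c 0 (d - a - e)

include ha hb hc in
lemma le_mul_sum_secondDiff {e : ℕ} (hnonneg : ∀ d, 0 ≤ secondDiff K a b c e d) {M : ℤ} :
    a * e * (M - a - e) ≤ a * b * c * ∑ d ∈ Finset.Ico 0 M, secondDiff K a b c e d := by
  have hneg (d : ℤ) (hd : d < 0) : secondDiff K a b c e d = 0 := by
    rw [secondDiff, symbDim_neg hd, symbDim_neg (by lia), symbDim_neg (by lia),
      symbDim_neg (by lia)]
    rfl
  have hbox (d : ℤ) : 0 ≤ boxSum a b c (secondDiff K a b c e) d :=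
    Finset.sum_nonneg fun t _ => hnonneg _
  calc (a * e * (M - a - e) : ℤ)
      ≤ ∑ d ∈ Finset.Ico (a + e : ℤ) M, (a * e : ℤ) := by
        rw [Finset.sum_const, Int.card_Ico, nsmul_eq_mul, mul_comm]
        gcongr
        lia
    _ = ∑ d ∈ Finset.Ico (a + e : ℤ) M, boxSum a b c (secondDiff K a b c e) d := by
        refine Finset.sum_congr rfl fun d hd => ?_
        exact (boxSum_second_difference (K := K) ha hb hc (Nat.cast_nonneg a)
          (Nat.cast_nonneg e) (Finset.mem_Ico.mp hd).1).symm
    _ ≤ ∑ d ∈ Finset.Ico 0 M, boxSum a b c (secondDiff K a b c e) d :=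
        Finset.sum_le_sum_of_subset_of_nonneg (Finset.Ico_subset_Ico_left (by lia))
          fun d _ _ => hbox d
    _ = ∑ t : (i : Fin 3) → Fin (wt a b c i), ∑ d ∈ Finset.Ico 0 M,
          secondDiff K a b c e (d - ∑ i, (t i : ℤ)) := Finset.sum_comm
    _ ≤ ∑ t : (i : Fin 3) → Fin (wt a b c i), ∑ d ∈ Finset.Ico 0 M, secondDiff K a b c e d :=
        Finset.sum_le_sum fun t _ => sum_Ico_sub_le hnonneg hneg M (box_le t).1
    _ = a * b * c * ∑ d ∈ Finset.Ico 0 M, secondDiff K a b c e d := by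
        rw [Finset.sum_const, Finset.card_univ, card_box, nsmul_eq_mul]
        push_cast
        rfl

variable {g₁ g₂ : MvPolynomial (Fin 3) K} {r₁ r₂ d₁ d₂ : ℕ}
  (hr₁ : 0 < r₁) (hr₂ : 0 < r₂) (hg₁ : Irreducible g₁) (h₁ : HasOrder a b c g₁ r₁)
  (hd₁ : IsWeightedHomogeneous (intWt a b c) g₁ (d₁ : ℤ)) (hle : d₁ * r₂ ≤ d₂ * r₁)
  (hslope : ∀ (n : ℕ) (e : ℤ), ∀ f ∈ symbPiece K a b c n e, ¬ g₁ ∣ f → (d₂ : ℤ) * n ≤ e * r₂)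

include ha hb hc hab hr₁ hg₁ h₁ hd₁ in
lemma secondDiff_nonneg (d : ℤ) : 0 ≤ secondDiff K a b c d₁ d := by
  have hord := hasOrder_X (K := K) (c := c) ha hb hab 0
  have hX0 : X 0 ∉ pIdeal K a b c := fun h => hord.2 (mem_symbPow_one h)
  have hrel : IsRelPrime (X 0) g₁ := by
    refine (X_prime.irreducible.isRelPrime_iff_not_dvd).mpr ?_
    rintro ⟨u, rfl⟩
    have hP := symbPow_le_pIdeal ha hb hab hr₁ h₁.1
    have hu := ((pIdeal_isPrime K a b c).mem_or_mem hP).resolve_left hX0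
    obtain hunit | hunit := hg₁.isUnit_or_isUnit rfl
    · exact X_prime.not_isUnit hunit
    · exact (pIdeal_isPrime K a b c).ne_top (Ideal.eq_top_of_isUnit_mem _ hu hunit)
  have := symbDim_add_le ha hb hc hab hord h₁
    (isWeightedHomogeneous_X K (intWt a b c) 0) hd₁ hrel 0 d
  simp only [Nat.zero_sub] at this
  rw [secondDiff]
  change _ ≤ symbDim K a b c 0 d at this
  simp only [intWt, wt, Matrix.cons_val] at this
  linarith

include ha hb hab h₁ hd₁ hslope in
lemma symbDim_eq_of_lt {n : ℕ} {d : ℤ} (hd : d * r₂ < d₂ * n) :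
    symbDim K a b c n d = symbDim K a b c (n - r₁) (d - d₁) := by
  have h : symbPiece K a b c n d = mulImage g₁ (symbPiece K a b c (n - r₁) (d - d₁)) := by
    ext f
    rw [mem_mulImage]
    constructor
    · intro hf
      by_cases hdvd : g₁ ∣ f
      · obtain ⟨u, rfl⟩ := hdvd
        exact ⟨u, (h₁.mul_mem_symbPiece_iff ha hb hab hd₁).mp hf, rfl⟩
      · exact absurd (hslope n d f hf hdvd) (not_le.mpr hd)
    · rintro ⟨u, hu, rfl⟩
      exact (h₁.mul_mem_symbPiece_iff ha hb hab hd₁).mpr hu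
  rw [symbDim, h, finrank_mulImage h₁.ne_zero, symbDim]

include ha hb hab h₁ hd₁ hslope in
lemma codimGrowth_eq_of_lt {n : ℕ} {d : ℤ} (hd : d * r₂ < d₂ * n) :
    codimGrowth K a b c n d = secondDiff K a b c d₁ d + codimGrowth K a b c (n - r₁) (d - d₁) := by
  have hd' : (d - a) * r₂ < d₂ * n := by
    have : (0 : ℤ) ≤ a * r₂ := by positivity
    linarith
  rw [codimGrowth, symbDim_eq_of_lt ha hb hab h₁ hd₁ hslope hd,
    symbDim_eq_of_lt ha hb hab h₁ hd₁ hslope hd', codimGrowth, secondDiff, sub_right_comm d]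
  ring

include ha hb hc hab hr₂ h₁ hd₁ hle hslope in
lemma sum_secondDiff_add_le (k : ℕ) :
    ∑ d ∈ Finset.Ico 0 ((d₂ * (r₁ * (k + 1)) / r₂ : ℕ) : ℤ), secondDiff K a b c d₁ d +
      ∑ d ∈ Finset.Ico 0 ((d₂ * (r₁ * k) / r₂ : ℕ) : ℤ), codimGrowth K a b c (r₁ * k) d ≤
    ∑ d ∈ Finset.Ico 0 ((d₂ * (r₁ * (k + 1)) / r₂ : ℕ) : ℤ),
      codimGrowth K a b c (r₁ * (k + 1)) d := by
  set M := d₂ * (r₁ * (k + 1)) / r₂ with hM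
  set M' := d₂ * (r₁ * k) / r₂ with hM'
  have hMM' : M' + d₁ ≤ M := by
    rw [hM, Nat.le_div_iff_mul_le hr₂, add_mul]
    have := Nat.div_mul_le_self (d₂ * (r₁ * k)) r₂
    calc M' * r₂ + d₁ * r₂ ≤ d₂ * (r₁ * k) + d₂ * r₁ := add_le_add this hle
      _ = d₂ * (r₁ * (k + 1)) := by ring
  have hlt (d : ℤ) (hd : d ∈ Finset.Ico 0 (M : ℤ)) :
      codimGrowth K a b c (r₁ * (k + 1)) d =
        secondDiff K a b c d₁ d + codimGrowth K a b c (r₁ * k) (d - d₁) := by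
    rw [codimGrowth_eq_of_lt ha hb hab h₁ hd₁ hslope, mul_add_one, Nat.add_sub_cancel]
    have h2 : M * r₂ ≤ d₂ * (r₁ * (k + 1)) := Nat.div_mul_le_self _ r₂
    calc d * r₂ < M * r₂ := by
          have := (Finset.mem_Ico.mp hd).2
          gcongr
      _ ≤ d₂ * (r₁ * (k + 1) : ℕ) := by exact_mod_cast h2
  rw [Finset.sum_congr rfl hlt, Finset.sum_add_distrib, sum_Ico_sub_eq]
  refine add_le_add le_rfl (Finset.sum_le_sum_of_subset_of_nonneg
    (Finset.Ico_subset_Ico ?_ ?_) fun d _ _ => codimGrowth_nonneg ha hb hc hab _ d) <;> lia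

include ha hb hc hab hr₁ hr₂ hg₁ h₁ hd₁ hle hslope in
lemma mul_le_mul_orders_of_slope : d₁ * d₂ ≤ a * b * c * (r₁ * r₂) := by
  set A : ℕ → ℤ := fun k =>
    ∑ d ∈ Finset.Ico 0 ((d₂ * (r₁ * k) / r₂ : ℕ) : ℤ), codimGrowth K a b c (r₁ * k) d with hA
  have hnonneg := secondDiff_nonneg ha hb hc hab hr₁ hg₁ h₁ hd₁
  have hstep (k : ℕ) : (a * d₁ * (d₂ * (r₁ * (k + 1)) - r₂ * (1 + a + d₁)) : ℤ) ≤
      a * b * c * r₂ * (A (k + 1) - A k) := by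
    have h3 := sum_secondDiff_add_le ha hb hc hab hr₂ h₁ hd₁ hle hslope k
    have h4 := le_mul_sum_secondDiff (K := K) ha hb hc hnonneg
      (M := (d₂ * (r₁ * (k + 1)) / r₂ : ℕ))
    have h5 : d₂ * (r₁ * (k + 1)) ≤ r₂ * (d₂ * (r₁ * (k + 1)) / r₂ + 1) :=
      (Nat.lt_mul_div_succ _ hr₂).le
    set M := d₂ * (r₁ * (k + 1)) / r₂
    calc (a * d₁ * (d₂ * (r₁ * (k + 1)) - r₂ * (1 + a + d₁)) : ℤ)
        ≤ a * d₁ * (r₂ * (M + 1) - r₂ * (1 + a + d₁)) := by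
          have h5' : (d₂ * (r₁ * (k + 1)) : ℤ) ≤ r₂ * (M + 1) := by exact_mod_cast h5
          exact mul_le_mul_of_nonneg_left (sub_le_sub_right h5' _) (by positivity)
      _ = r₂ * (a * d₁ * (M - a - d₁)) := by ring
      _ ≤ r₂ * (a * b * c * (A (k + 1) - A k)) := by
          refine mul_le_mul_of_nonneg_left (h4.trans ?_) (by positivity)
          gcongr
          exact le_sub_iff_add_le.mpr h3
      _ = _ := by ring
  have hsum (k : ℕ) : (a * d₁ * (d₂ * r₁ * (k * (k + 1)) - 2 * r₂ * (1 + a + d₁) * k) : ℤ) ≤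
      2 * (a * b * c * r₂ * A k) := by
    induction k with
    | zero =>
      have : 0 ≤ A 0 := Finset.sum_nonneg fun d _ => codimGrowth_nonneg ha hb hc hab _ d
      have : (0 : ℤ) ≤ 2 * (a * b * c * r₂ * A 0) := by positivity
      simpa using this
    | succ k ih =>
      have := hstep k
      push_cast
      linarith
  have hbound (k : ℕ) : 2 * A k ≤ a * ((r₁ * k) * (r₁ * k + 1)) := by
    have := sum_codimGrowth_le (K := K) ha hb hc hab (r₁ * k)
      (M := (d₂ * (r₁ * k) / r₂ : ℕ)) (Nat.cast_nonneg _)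
    exact_mod_cast this
  by_contra! hcon
  have hcon' : (a * b * c * (r₁ * r₂) + 1 : ℤ) ≤ d₁ * d₂ := by exact_mod_cast hcon
  set k : ℕ := a * b * c * r₂ * a * r₁ + 2 * a * d₁ * r₂ * (1 + a + d₁) + 1 with hk
  have key : (a * d₁ * (d₂ * r₁ * (k * (k + 1)) - 2 * r₂ * (1 + a + d₁) * k) : ℤ) ≤
      a * b * c * r₂ * (a * ((r₁ * k) * (r₁ * k + 1))) := by
    refine (hsum k).trans ?_
    rw [← mul_left_comm]
    exact mul_le_mul_of_nonneg_left (hbound k) (by positivity)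
  have hk0 : (0 : ℤ) < k := by exact_mod_cast Nat.succ_pos _
  have key' : (a * d₁ * (d₂ * r₁ * (k + 1) - 2 * r₂ * (1 + a + d₁)) : ℤ) ≤
      a * b * c * r₂ * (a * (r₁ * (r₁ * k + 1))) := by
    refine le_of_mul_le_mul_right ?_ hk0
    linarith
  have h6 : (a * r₁ * (k + 1) * (a * b * c * (r₁ * r₂) + 1) : ℤ) ≤
      a * r₁ * (k + 1) * (d₁ * d₂) := mul_le_mul_of_nonneg_left hcon' (by positivity)
  have h7 : (k + 1 : ℤ) ≤ a * r₁ * (k + 1) := by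
    have : (1 : ℤ) ≤ a * r₁ := by exact_mod_cast Nat.mul_pos ha hr₁
    nlinarith
  have h8 : (0 : ℤ) ≤ a * r₁ * (a * b * c * (r₁ * r₂)) := by positivity
  have hk' : (k : ℤ) = a * b * c * r₂ * a * r₁ + 2 * a * d₁ * r₂ * (1 + a + d₁) + 1 := by
    exact_mod_cast hk
  linarith

end Counting

section Existence

variable {K : Type*} [Field K] {a b c : ℕ} (ha : 0 < a) (hb : 0 < b) (hc : 0 < c)
  (hab : a.Coprime b)

include ha hb hc hab in
theorem exists_isRegular_of_isNoetherianRing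
    (h : IsNoetherianRing (symbolicRees (pIdeal K a b c))) :
    ∃ (g₁ g₂ : MvPolynomial (Fin 3) K) (r₁ r₂ d₁ d₂ : ℕ), 0 < r₁ ∧ 0 < r₂ ∧ 0 < d₁ ∧ 0 < d₂ ∧
      RingTheory.Sequence.IsRegular (MvPolynomial (Fin 3) K) [g₁, g₂] ∧
      g₁ ∈ symbPow (pIdeal K a b c) r₁ ∧ IsWeightedHomogeneous (intWt a b c) g₁ (d₁ : ℤ) ∧
      g₂ ∈ symbPow (pIdeal K a b c) r₂ ∧ IsWeightedHomogeneous (intWt a b c) g₂ (d₂ : ℤ) ∧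
      d₁ * d₂ = a * b * c * (r₁ * r₂) := by
  obtain ⟨r₁, d₁, g₁, hr₁, hd₁0, hg₁, hd₁, h₁, hslope₁⟩ :=
    exists_irreducible_minimal_slope ha hb hc hab h
  have hq : ∃ n d, 0 < n ∧ ∃ f ∈ symbPiece K a b c n d, f ∉ Ideal.span {g₁} := by
    by_contra! hcon
    refine not_dvd_and_dvd (by exact_mod_cast hd₁0.ne') hd₁ hb hc
      (Ideal.mem_span_singleton.mp (hcon 1 (a * b) one_pos _ (mem_symbPiece.mpr ⟨?_, ?_⟩)))
      (Ideal.mem_span_singleton.mp (hcon 1 (a * c) one_pos _ (mem_symbPiece.mpr ⟨?_, ?_⟩)))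
    exacts [mem_symbPow_one X_one_pow_sub_mem_pIdeal, isWeightedHomogeneous_X_one_pow_sub,
      mem_symbPow_one X_two_pow_sub_mem_pIdeal, isWeightedHomogeneous_X_two_pow_sub]
  obtain ⟨r₂, d₂, hr₂, ⟨g₂, hg₂, hdvd⟩, hslope₂⟩ := exists_minimal_slope ha hb hab h _ hq
  simp only [Ideal.mem_span_singleton] at hdvd hslope₂
  have hg₂0 : g₂ ≠ 0 := fun h0 => hdvd (h0 ▸ dvd_zero g₁)
  have hd₂0 := pos_of_mem_symbPiece ha hb hc hab hg₂ hg₂0 hr₂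
  lift d₂ to ℕ using hd₂0.le
  obtain ⟨hgs₂, hd₂⟩ := mem_symbPiece.mp hg₂
  obtain ⟨o, h₂⟩ := exists_hasOrder ha hb hab hg₂0
  have hrel : IsRelPrime g₁ g₂ := hg₁.isRelPrime_iff_not_dvd.mpr hdvd
  have hle : d₁ * r₂ ≤ d₂ * r₁ := by exact_mod_cast hslope₁ r₂ d₂ g₂ hg₂ hg₂0
  have hP₁ := symbPow_le_pIdeal ha hb hab hr₁ h₁.1
  have hP₂ := symbPow_le_pIdeal ha hb hab hr₂ hgs₂
  refine ⟨g₁, g₂, r₁, r₂, d₁, d₂, hr₁, hr₂, hd₁0, by exact_mod_cast hd₂0,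
    isRegular_pair_iff.mpr ⟨hg₁.ne_zero, fun x hx => hrel.dvd_of_dvd_mul_left hx, fun htop => ?_⟩,
    h₁.1, hd₁, hgs₂, hd₂, le_antisymm ?_ ?_⟩
  · refine (pIdeal_isPrime K a b c).ne_top (top_le_iff.mp (htop ▸ Ideal.span_le.mpr ?_))
    rintro _ (rfl | rfl)
    exacts [hP₁, hP₂]
  · exact mul_le_mul_orders_of_slope ha hb hc hab hr₁ hr₂ hg₁ h₁ hd₁ hle hslope₂
  · refine le_trans ?_ (mul_orders_le ha hb hc hab h₁ h₂ hd₁ hd₂ hrel)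
    gcongr
    exact h₂.le_of_mem hgs₂

end Existence

/-- `R_s(𝔭_K(a,b,c))` is Noetherian iff Huneke's condition holds:
there is a regular sequence `g1 ∈ [𝔭^{(r1)}]_{d1}`, `g2 ∈ [𝔭^{(r2)}]_{d2}` with
`d1·d2 = abc·r1·r2`. -/
theorem statement2 (K : Type*) [Field K] (a b c : ℕ)
    (ha : 0 < a) (hb : 0 < b) (hc : 0 < c)
    (hab : Nat.Coprime a b) (hbc : Nat.Coprime b c) (hca : Nat.Coprime c a) :
    IsNoetherianRing (symbolicRees (pIdeal K a b c)) ↔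
      ∃ (g1 g2 : MvPolynomial (Fin 3) K) (r1 r2 d1 d2 : ℕ),
        0 < r1 ∧ 0 < r2 ∧ 0 < d1 ∧ 0 < d2 ∧
        RingTheory.Sequence.IsRegular (MvPolynomial (Fin 3) K) [g1, g2] ∧
        g1 ∈ symbPow (pIdeal K a b c) r1 ∧
        g1.IsWeightedHomogeneous (wt a b c) d1 ∧
        g2 ∈ symbPow (pIdeal K a b c) r2 ∧
        g2.IsWeightedHomogeneous (wt a b c) d2 ∧
        d1 * d2 = a * b * c * (r1 * r2) := by
  constructor
  · intro h
    obtain ⟨g₁, g₂, r₁, r₂, d₁, d₂, hr₁, hr₂, hd₁, hd₂, hreg, hg₁, hh₁, hg₂, hh₂, heq⟩ :=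
      exists_isRegular_of_isNoetherianRing ha hb hc hab h
    exact ⟨g₁, g₂, r₁, r₂, d₁, d₂, hr₁, hr₂, hd₁, hd₂, hreg, hg₁,
      isWeightedHomogeneous_intWt.mp hh₁, hg₂, isWeightedHomogeneous_intWt.mp hh₂, heq⟩
  · rintro ⟨g₁, g₂, r₁, r₂, d₁, d₂, hr₁, hr₂, -, -, hreg, hg₁, hh₁, hg₂, hh₂, heq⟩
    obtain ⟨h₁, h₂, hrel⟩ := isRelPrime_of_isRegular hreg
    exact isNoetherianRing_symbolicRees ha hb hc hab hr₁ hr₂ hg₁ hg₂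
      (isWeightedHomogeneous_intWt.mpr hh₁) (isWeightedHomogeneous_intWt.mpr hh₂) h₁ h₂ hrel heq
end

section
/- Let K be a field of characteristic 0. The K-vector space [𝔭_K(5,103,169)^{(7)}]_{2065} is one-dimensional, and it is spanned by an irreducible polynomial f in which the coefficient of x^{413} is nonzero (in particular f ∉ (y,z)S). Since 2065/7 < √(5·103·169), this f is a negative curve. -/
open MvPolynomial

/-! ### Symbolic powers of prime ideals -/

section SymbolicPower

variable {A : Type*} [CommRing A] (Q : Ideal A) [Q.IsPrime]

theorem mem_symbPow_iff_s4 {n : ℕ} {f : A} : f ∈ symbPow Q n ↔ ∃ s ∉ Q, s * f ∈ Q ^ n := by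
  rw [symbPow, Ideal.mem_comap, IsLocalization.algebraMap_mem_map_algebraMap_iff Q.primeCompl]
  rfl

theorem symbPow_le_self {n : ℕ} (hn : n ≠ 0) : symbPow Q n ≤ Q := by
  intro f hf
  obtain ⟨s, hs, hsf⟩ := (mem_symbPow_iff_s4 Q).1 hf
  exact ((‹Q.IsPrime›).mem_or_mem (Ideal.pow_le_self hn hsf)).resolve_left hs

theorem symbPow_succ_le (n : ℕ) : symbPow Q (n + 1) ≤ symbPow Q n :=
  Ideal.comap_mono (Ideal.map_mono (Ideal.pow_le_pow_right n.le_succ))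

theorem derivation_mem_pow {R : Type*} [CommRing R] [Algebra R A] (D : Derivation R A A)
    (I : Ideal A) (n : ℕ) {f : A} (hf : f ∈ I ^ (n + 1)) : D f ∈ I ^ n := by
  induction n generalizing f with
  | zero => simp
  | succ n ih =>
    rw [pow_succ'] at hf
    induction hf using Submodule.mul_induction_on' with
    | mem_mul_mem a ha b hb =>
      rw [D.leibniz, smul_eq_mul, smul_eq_mul, pow_succ']
      refine add_mem (Ideal.mul_mem_mul ha (ih hb)) ?_
      rw [← pow_succ']
      exact Ideal.mul_mem_right _ _ hb
    | add a _ b _ ha hb => simpa using add_mem ha hb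

/-- Derivations lower the order of a symbolic power by at most one. -/
theorem derivation_mem_symbPow {R : Type*} [CommRing R] [Algebra R A] (D : Derivation R A A)
    (n : ℕ) {f : A} (hf : f ∈ symbPow Q (n + 1)) : D f ∈ symbPow Q n := by
  obtain ⟨s, hs, hsf⟩ := (mem_symbPow_iff_s4 Q).1 hf
  refine (mem_symbPow_iff_s4 Q).2 ⟨s * s, (‹Q.IsPrime›).mul_notMem hs hs, ?_⟩
  have h : s * s * D f = s * D (s * f) - D s * (s * f) := by
    rw [D.leibniz, smul_eq_mul, smul_eq_mul]; ring
  rw [h]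
  exact sub_mem (Ideal.mul_mem_left _ _ (derivation_mem_pow D Q n hsf))
    (Ideal.mul_mem_left _ _ (Ideal.pow_le_pow_right n.le_succ hsf))

end SymbolicPower

/-! ### Factorizations and weights -/

section Weight

variable {σ K : Type*} [Field K]

/-- Weights of exponents of two factors add up to at most the largest weight of the product. -/
theorem weight_add_weight_le (w : σ → ℕ) {g h : MvPolynomial σ K} {N : ℕ}
    (hN : ∀ m ∈ (g * h).support, Finsupp.weight w m ≤ N) {a b : σ →₀ ℕ}
    (ha : a ∈ g.support) (hb : b ∈ h.support) :
    Finsupp.weight w a + Finsupp.weight w b ≤ N := by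
  classical
  let φ : MvPolynomial σ K →ₐ[K] Polynomial (MvPolynomial σ K) :=
    aeval fun i => Polynomial.C (X i) * Polynomial.X ^ w i
  have hmon : ∀ (m : σ →₀ ℕ) (c : K), φ (monomial m c) =
      Polynomial.C (monomial m c) * Polynomial.X ^ Finsupp.weight w m := by
    intro m c
    have hC : Polynomial.C (monomial m c : MvPolynomial σ K) =
        algebraMap K (Polynomial (MvPolynomial σ K)) c *
          m.prod fun i k => Polynomial.C (X i) ^ k := by
      rw [monomial_eq, map_mul, Finsupp.prod, map_prod]
      simp only [map_pow, Finsupp.prod]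
      rfl
    rw [aeval_monomial, hC, Finsupp.weight_apply, mul_assoc]
    congr 1
    simp only [Finsupp.prod, Finsupp.sum, mul_pow, Finset.prod_mul_distrib, ← pow_mul,
      Finset.prod_pow_eq_pow_sum, smul_eq_mul, mul_comm]
  have hcoeff : ∀ (p : MvPolynomial σ K) (n : ℕ) (m : σ →₀ ℕ),
      coeff m ((φ p).coeff n) = if Finsupp.weight w m = n then coeff m p else 0 := by
    intro p n m
    induction p using MvPolynomial.induction_on' with
    | monomial k c =>
      rw [hmon, Polynomial.coeff_C_mul, Polynomial.coeff_X_pow]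
      by_cases hk : k = m
      · subst hk
        by_cases hn : n = Finsupp.weight w k <;> simp [hn, eq_comm]
      · by_cases hn : n = Finsupp.weight w k <;> simp [hn, coeff_monomial, hk]
    | add p q hp hq =>
      rw [map_add, Polynomial.coeff_add, coeff_add, hp, hq, coeff_add]
      split_ifs <;> simp
  have hle : ∀ (p : MvPolynomial σ K) (m : σ →₀ ℕ), m ∈ p.support →
      Finsupp.weight w m ≤ (φ p).natDegree := by
    intro p m hm
    refine Polynomial.le_natDegree_of_ne_zero fun h0 => mem_support_iff.1 hm ?_
    simpa [h0] using (hcoeff p (Finsupp.weight w m) m).symm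
  have hne : ∀ (p : MvPolynomial σ K) (m : σ →₀ ℕ), m ∈ p.support → φ p ≠ 0 := by
    intro p m hm h0
    refine mem_support_iff.1 hm ?_
    simpa [h0] using (hcoeff p (Finsupp.weight w m) m).symm
  calc _ ≤ (φ g).natDegree + (φ h).natDegree := add_le_add (hle g a ha) (hle h b hb)
    _ = (φ (g * h)).natDegree := by
      rw [map_mul, Polynomial.natDegree_mul (hne g a ha) (hne h b hb)]
    _ ≤ N := by
      refine Polynomial.natDegree_le_iff_coeff_eq_zero.2 fun n hn => ?_
      ext m
      rw [hcoeff, coeff_zero, ite_eq_right_iff]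
      intro hm
      by_contra hc
      have := hN m (mem_support_iff.2 hc)
      lia

theorem isUnit_of_weight_support_eq_zero {w : σ → ℕ} (hw : ∀ i, w i ≠ 0)
    {g : MvPolynomial σ K} (hg : g ≠ 0) (h : ∀ m ∈ g.support, Finsupp.weight w m = 0) :
    IsUnit g := by
  classical
  have hC : g = C (coeff 0 g) := by
    ext m
    rw [coeff_C]
    split_ifs with hm
    · rw [hm]
    · by_contra hc
      refine hm (Eq.symm ?_)
      ext i
      have hi := Finsupp.le_weight w (hw i) m
      rw [h m (mem_support_iff.2 hc)] at hi
      simpa using hi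
  rw [hC] at hg ⊢
  exact (isUnit_iff_ne_zero.2 fun h0 => hg (by rw [h0, map_zero])).map C

theorem weight_fin_three (w : Fin 3 → ℕ) (m : Fin 3 →₀ ℕ) :
    Finsupp.weight w m = m 0 * w 0 + m 1 * w 1 + m 2 * w 2 := by
  rw [Finsupp.weight_apply, Finsupp.sum_fintype _ _ (by simp), Fin.sum_univ_three]
  simp

end Weight

/-! ### The derivations `x ↦ w₀ x, y ↦ w₁ y, z ↦ w₂ z` -/

section Euler

variable {K : Type*} [Field K]

theorem sum_monomial_mul_mem_symbPow {ι : Type*} [Fintype ι] (T : ι → Fin 3 →₀ ℕ)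
    (Q : Ideal (MvPolynomial (Fin 3) K)) [Q.IsPrime] (n : ℕ) (c : ι → K) (w : Fin 3 → K) (e : K)
    (h : ∑ t, monomial (T t) (c t) ∈ symbPow Q (n + 1)) :
    ∑ t, monomial (T t) ((∑ i, w i * T t i + e) * c t) ∈ symbPow Q n := by
  let D : Derivation K (MvPolynomial (Fin 3) K) (MvPolynomial (Fin 3) K) :=
    ∑ i, (C (w i) * X i : MvPolynomial (Fin 3) K) • pderiv i
  have hD : ∀ (m : Fin 3 →₀ ℕ) (a : K),
      D (monomial m a) = monomial m ((∑ i, w i * m i) * a) := by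
    intro m a
    have hD' : D (monomial m a) =
        ∑ i, (C (w i) * X i : MvPolynomial (Fin 3) K) * pderiv i (monomial m a) := by
      simp only [D, Fin.sum_univ_three, Derivation.add_apply, Derivation.smul_apply, smul_eq_mul]
    rw [hD', Finset.sum_mul, map_sum]
    refine Finset.sum_congr rfl fun i _ => ?_
    rw [mul_assoc, X_mul_pderiv_monomial, C_mul', smul_monomial, smul_monomial, nsmul_eq_mul,
      smul_eq_mul, mul_assoc]
  have key : ∑ t, monomial (T t) ((∑ i, w i * T t i + e) * c t) =
      D (∑ t, monomial (T t) (c t)) + C e * ∑ t, monomial (T t) (c t) := by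
    simp only [map_sum, hD, Finset.mul_sum, C_mul_monomial, ← Finset.sum_add_distrib, ← map_add,
      add_mul]
  rw [key]
  exact add_mem (derivation_mem_symbPow Q D n h)
    (Ideal.mul_mem_left _ _ (symbPow_succ_le Q n h))

/-- Iterating a shifted Euler operator multiplies coefficients by descending factorials of an
affine function of the exponent. -/
theorem sum_monomial_descFactorial_mem_symbPow {ι : Type*} [Fintype ι] (T : ι → Fin 3 →₀ ℕ)
    (Q : Ideal (MvPolynomial (Fin 3) K)) [Q.IsPrime] (w : Fin 3 → K) (e : K) (α : ι → ℕ)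
    (hα : ∀ t, ∑ i, w i * T t i + e = α t) (p n : ℕ) (c : ι → K)
    (h : ∑ t, monomial (T t) (c t) ∈ symbPow Q (n + p)) :
    ∑ t, monomial (T t) ((α t).descFactorial p * c t) ∈ symbPow Q n := by
  induction p generalizing n with
  | zero => simpa using h
  | succ p ih =>
    have h1 := sum_monomial_mul_mem_symbPow T Q n _ w (e - p)
      (ih (n + 1) (by convert h using 2; ring))
    convert h1 using 3 with t
    rw [Nat.descFactorial_succ, ← mul_assoc, add_sub, hα]
    congr 2
    rcases le_or_gt p (α t) with hp | hp
    · push_cast [hp]; ring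
    · simp [Nat.descFactorial_of_lt hp]

end Euler

/-! ### Order of vanishing along `v = w = 1` -/

/-- Binomial expansion of a polynomial in `v, w` at the point `(1, 1)`. -/
theorem sum_mul_pow_mul_pow_mem {R ι : Type*} [CommRing R] [Fintype ι] (I : Ideal R) {v w : R}
    (hv : v - 1 ∈ I) (hw : w - 1 ∈ I) (α β : ι → ℕ) (c : ι → ℤ) (n : ℕ)
    (hc : ∀ p q, p + q < n → ∑ t, c t * ((α t).choose p * (β t).choose q) = 0) :
    ∑ t, (c t : R) * (v ^ α t * w ^ β t) ∈ I ^ n := by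
  obtain ⟨M, hM⟩ : ∃ M, ∀ t, α t < M ∧ β t < M :=
    ⟨∑ t, (α t + β t) + 1, fun t => by
      have := Finset.single_le_sum (f := fun t => α t + β t) (fun _ _ => Nat.zero_le _)
        (Finset.mem_univ t)
      lia⟩
  have expand : ∀ (u : R) (k : ℕ), k < M →
      u ^ k = ∑ p ∈ Finset.range M, (u - 1) ^ p * (k.choose p : R) := by
    intro u k hk
    conv_lhs => rw [← sub_add_cancel u 1, add_pow]
    simp only [one_pow, mul_one]
    refine Finset.sum_subset (Finset.range_mono hk) fun p _ hp => ?_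
    rw [Nat.choose_eq_zero_of_lt (by simpa using hp), Nat.cast_zero, mul_zero]
  have key : ∑ t, (c t : R) * (v ^ α t * w ^ β t) = ∑ p ∈ Finset.range M, ∑ q ∈ Finset.range M,
      (∑ t, (c t : R) * ((α t).choose p * (β t).choose q)) * ((v - 1) ^ p * (w - 1) ^ q) := by
    calc _ = ∑ t, ∑ p ∈ Finset.range M, ∑ q ∈ Finset.range M,
          (c t : R) * ((α t).choose p * (β t).choose q) * ((v - 1) ^ p * (w - 1) ^ q) := by
          refine Finset.sum_congr rfl fun t _ => ?_
          rw [expand v _ (hM t).1, expand w _ (hM t).2, Finset.sum_mul_sum, Finset.mul_sum]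
          refine Finset.sum_congr rfl fun p _ => ?_
          rw [Finset.mul_sum]
          exact Finset.sum_congr rfl fun q _ => by ring
      _ = _ := by
          rw [Finset.sum_comm]
          refine Finset.sum_congr rfl fun p _ => ?_
          rw [Finset.sum_comm]
          exact Finset.sum_congr rfl fun q _ => (Finset.sum_mul ..).symm
  rw [key]
  refine sum_mem fun p _ => sum_mem fun q _ => ?_
  rcases lt_or_ge (p + q) n with h | h
  · have h0 := congrArg (Int.cast : ℤ → R) (hc p q h)
    push_cast at h0
    rw [h0, zero_mul]
    exact zero_mem _
  · refine Ideal.mul_mem_left _ _ (Ideal.pow_le_pow_right h ?_)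
    rw [pow_add]
    exact Ideal.mul_mem_mul (Ideal.pow_mem_pow hv p) (Ideal.pow_mem_pow hw q)

/-! ### The monomials of degree `2065` -/

namespace NegativeCurve

/-- With `v = y² z / x⁷⁵` and `w = y z³ / x¹²²`, the `t`-th monomial of degree `2065` is
`x⁴¹³ v ^ (vExp t - 2) w ^ (wExp t - 4)`. -/
def vExp : Fin 29 → ℕ :=
  ![2, 5, 8, 11, 14, 3, 6, 9, 12, 4, 7, 10, 2, 5, 8, 3, 6, 9, 1, 4, 7, 2, 5, 3, 1, 4, 2, 0, 1]

/-- The exponent of `w`, shifted by `4`; see `vExp`. -/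
def wExp : Fin 29 → ℕ :=
  ![4, 3, 2, 1, 0, 4, 3, 2, 1, 4, 3, 2, 5, 4, 3, 5, 4, 3, 6, 5, 4, 6, 5, 6, 7, 6, 7, 8, 8]

/-- The exponents `(i, j, k)` of the `t`-th monomial of degree `2065`. -/
def expo (t : Fin 29) : Fin 3 → ℕ :=
  ![1051 - 75 * vExp t - 122 * wExp t, 2 * vExp t + wExp t - 8, vExp t + 3 * wExp t - 14]

/-- `expo` as a finitely supported function. -/
noncomputable def mexp (t : Fin 29) : Fin 3 →₀ ℕ := Finsupp.equivFunOnFinite.symm (expo t)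

/-- The coefficients of the negative curve. -/
def crv : Fin 29 → ℤ :=
  ![-1, -4, -6, -3, 1, 11, 32, 25, -6, -43, -66, 16, -4, 43, -40, 37, 94, 1, -1, -98, 1, -2, -26,
    48, -3, 4, -12, 1, 1]

theorem mexp_apply (t : Fin 29) (i : Fin 3) : mexp t i = expo t i := rfl

theorem expo_spec : ∀ t, expo t 0 + 75 * vExp t + 122 * wExp t = 1051 ∧
    expo t 1 + 8 = 2 * vExp t + wExp t ∧ expo t 2 + 14 = vExp t + 3 * wExp t := by
  decide +kernel

theorem expo_injective : ∀ t u, expo t 1 = expo u 1 → expo t 2 = expo u 2 → t = u := by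
  decide +kernel

theorem mexp_injective : Function.Injective mexp := fun t u h =>
  expo_injective t u (DFunLike.congr_fun h 1) (DFunLike.congr_fun h 2)

theorem exists_expo_eq : ∀ j < 21, ∀ k < 13, 103 * j + 169 * k ≤ 2065 →
    (2065 - 103 * j - 169 * k) % 5 = 0 → ∃ t, expo t 1 = j ∧ expo t 2 = k := by
  decide +kernel

theorem weight_mexp (t : Fin 29) : Finsupp.weight (wt 5 103 169) (mexp t) = 2065 := by
  obtain ⟨h0, h1, h2⟩ := expo_spec t
  rw [weight_fin_three]
  simp only [mexp_apply, wt, Matrix.cons_val]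
  lia

theorem exists_mexp_eq {m : Fin 3 →₀ ℕ} (hm : Finsupp.weight (wt 5 103 169) m = 2065) :
    ∃ t, mexp t = m := by
  rw [weight_fin_three] at hm
  simp only [wt, Matrix.cons_val] at hm
  obtain ⟨t, hj, hk⟩ := exists_expo_eq (m 1) (by lia) (m 2) (by lia) (by lia) (by lia)
  obtain ⟨h0, h1, h2⟩ := expo_spec t
  refine ⟨t, ?_⟩
  ext i
  fin_cases i <;> simp only [mexp_apply, Fin.reduceFinMk, Fin.zero_eta, Fin.mk_one] <;> lia

theorem crv_vanish : ∀ p < 7, ∀ q < 7, p + q < 7 →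
    ∑ t, crv t * ((vExp t).choose p * (wExp t).choose q) = 0 := by
  decide +kernel

/-- The pairs `(p, q)` with `p + q < 7`. -/
def ord : Fin 28 → ℕ × ℕ :=
  ![(0, 0), (0, 1), (0, 2), (0, 3), (0, 4), (0, 5), (0, 6), (1, 0), (1, 1), (1, 2), (1, 3), (1, 4),
    (1, 5), (2, 0), (2, 1), (2, 2), (2, 3), (2, 4), (3, 0), (3, 1), (3, 2), (3, 3), (4, 0), (4, 1),
    (4, 2), (5, 0), (5, 1), (6, 0)]

theorem ord_lt : ∀ r, (ord r).1 + (ord r).2 < 7 := by decide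

/-- The matrix of the vanishing conditions at all monomials except `y² z¹¹`. -/
def condMatrix : Matrix (Fin 28) (Fin 28) ℤ := fun r t =>
  (vExp t.castSucc).choose (ord r).1 * (wExp t.castSucc).choose (ord r).2

/-- The rows, in binary, of the inverse of `condMatrix` modulo `2`. -/
def invBits : Fin 28 → ℕ :=
  ![176726666, 67634432, 28362246, 150101936, 28568266, 100665216, 78202122, 6528, 76042272,
    234095232, 2097152, 231395440, 2703360, 3934080, 2163720, 148529072, 184985664, 215632816,
    3153792, 77665578, 104597376, 234573936, 2622720, 3145728, 150096560, 25247754, 76039434,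
    231335183]

/-- The inverse of `condMatrix` modulo `2`. -/
def invMatrix : Matrix (Fin 28) (Fin 28) ℤ := fun t r => if (invBits t).testBit r then 1 else 0

theorem invMatrix_mul_condMatrix : ∀ t u, (∑ r, invMatrix t r * condMatrix r u) % 2 =
    if t = u then 1 else 0 := by
  decide +kernel

theorem det_condMatrix_ne_zero : condMatrix.det ≠ 0 := by
  intro h0
  have h1 : (invMatrix * condMatrix).map (Int.castRingHom (ZMod 2)) = 1 := by
    ext t u
    rw [Matrix.map_apply, Matrix.mul_apply, Matrix.one_apply, eq_intCast,
      ← ZMod.intCast_mod, Nat.cast_ofNat, invMatrix_mul_condMatrix]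
    split_ifs <;> simp
  have h2 := congrArg Matrix.det h1
  rw [← RingHom.mapMatrix_apply, ← RingHom.map_det, Matrix.det_mul, h0, mul_zero, map_zero,
    Matrix.det_one] at h2
  exact zero_ne_one h2

section Field

variable (K : Type*) [Field K]

/-- The equation of the negative curve. -/
noncomputable def curve : MvPolynomial (Fin 3) K := ∑ t, monomial (mexp t) (crv t : K)

variable {K}

theorem coeff_sum_monomial_mexp (c : Fin 29 → K) (t : Fin 29) :
    coeff (mexp t) (∑ u, monomial (mexp u) (c u)) = c t := by
  classical
  simp [coeff_sum, coeff_monomial, mexp_injective.eq_iff]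

theorem sum_monomial_mexp_mem (c : Fin 29 → K) : ∑ t, monomial (mexp t) (c t) ∈
    weightedHomogeneousSubmodule K (wt 5 103 169) 2065 :=
  sum_mem fun t _ => isWeightedHomogeneous_monomial _ _ _ (weight_mexp t)

theorem eq_sum_monomial_mexp {f : MvPolynomial (Fin 3) K}
    (hf : f ∈ weightedHomogeneousSubmodule K (wt 5 103 169) 2065) :
    f = ∑ t, monomial (mexp t) (coeff (mexp t) f) := by
  ext m
  by_cases hm : Finsupp.weight (wt 5 103 169) m = 2065
  · obtain ⟨t, rfl⟩ := exists_mexp_eq hm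
    rw [coeff_sum_monomial_mexp]
  · rw [IsWeightedHomogeneous.coeff_eq_zero hf m hm,
      IsWeightedHomogeneous.coeff_eq_zero (sum_monomial_mexp_mem _) m hm]

theorem sum_eq_zero_of_mem_pIdeal {c : Fin 29 → K}
    (h : ∑ t, monomial (mexp t) (c t) ∈ pIdeal K 5 103 169) : ∑ t, c t = 0 := by
  have hmon : ∀ t, toPoly K 5 103 169 (monomial (mexp t) (c t)) =
      Polynomial.C (c t) * Polynomial.X ^ 2065 := by
    intro t
    rw [toPoly, aeval_monomial, Finsupp.prod_fintype _ _ (by simp), Fin.prod_univ_three]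
    have hw := weight_mexp t
    rw [weight_fin_three] at hw
    simp only [wt, Matrix.cons_val] at hw ⊢
    rw [← pow_mul, ← pow_mul, ← pow_mul, ← pow_add, ← pow_add, Polynomial.algebraMap_eq]
    congr 2
    lia
  rw [pIdeal, RingHom.mem_ker, map_sum] at h
  have h' := congrArg (fun P => Polynomial.coeff P 2065) h
  simpa [hmon, Polynomial.finsetSum_coeff] using h'

theorem exponent_relations [CharZero K] (t : Fin 29) :
    (∑ i, (![0, 3 / 5, -1 / 5] : Fin 3 → K) i * mexp t i + 2 = vExp t) ∧
      ∑ i, (![0, -1 / 5, 2 / 5] : Fin 3 → K) i * mexp t i + 4 = wExp t := by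
  obtain ⟨-, h1, h2⟩ := expo_spec t
  have e1 : (expo t 1 : K) + 8 = 2 * vExp t + wExp t := by exact_mod_cast h1
  have e2 : (expo t 2 : K) + 14 = vExp t + 3 * wExp t := by exact_mod_cast h2
  simp only [Fin.sum_univ_three, Matrix.cons_val, mexp_apply]
  constructor
  · linear_combination (3 / 5) * e1 - (1 / 5) * e2
  · linear_combination (2 / 5) * e2 - (1 / 5) * e1

theorem sum_choose_eq_zero [CharZero K] {c : Fin 29 → K}
    (h : ∑ t, monomial (mexp t) (c t) ∈ symbPow (pIdeal K 5 103 169) 7) {p q : ℕ}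
    (hpq : p + q < 7) : ∑ t, (((vExp t).choose p * (wExp t).choose q : ℤ) : K) * c t = 0 := by
  obtain ⟨n, hn⟩ : ∃ n, 7 = n + 1 + p + q := ⟨6 - p - q, by lia⟩
  rw [hn] at h
  have h1 := sum_monomial_descFactorial_mem_symbPow mexp _ _ _ _
    (fun t => (exponent_relations t).2) q _ _ h
  have h2 := sum_monomial_descFactorial_mem_symbPow mexp _ _ _ _
    (fun t => (exponent_relations t).1) p _ _ h1
  have h3 := sum_eq_zero_of_mem_pIdeal (symbPow_le_self _ n.succ_ne_zero h2)
  simp only [Nat.descFactorial_eq_factorial_mul_choose, Nat.cast_mul] at h3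
  have h4 : (p.factorial * q.factorial : K) *
      ∑ t, (((vExp t).choose p * (wExp t).choose q : ℤ) : K) * c t = 0 := by
    rw [← h3, Finset.mul_sum]
    refine Finset.sum_congr rfl fun t _ => ?_
    push_cast
    ring
  exact (mul_eq_zero.1 h4).resolve_left
    (mul_ne_zero (Nat.cast_ne_zero.2 p.factorial_ne_zero) (Nat.cast_ne_zero.2 q.factorial_ne_zero))

theorem eq_zero_of_coeff_last_eq_zero [CharZero K] {c : Fin 29 → K}
    (h : ∑ t, monomial (mexp t) (c t) ∈ symbPow (pIdeal K 5 103 169) 7)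
    (h0 : c (Fin.last 28) = 0) : c = 0 := by
  have hdet : (condMatrix.map (Int.castRingHom K)).det ≠ 0 := by
    rw [← RingHom.mapMatrix_apply, ← RingHom.map_det, eq_intCast]
    exact Int.cast_ne_zero.2 det_condMatrix_ne_zero
  have hc : (fun t : Fin 28 => c t.castSucc) = 0 := by
    refine Matrix.eq_zero_of_mulVec_eq_zero hdet (funext fun r => ?_)
    have hr := sum_choose_eq_zero h (ord_lt r)
    rw [Fin.sum_univ_castSucc, h0, mul_zero, add_zero] at hr
    exact hr
  funext t
  refine Fin.lastCases h0 (fun i => ?_) t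
  exact congrFun hc i

theorem curve_mem_symbPow : curve K ∈ symbPow (pIdeal K 5 103 169) 7 := by
  let Q := pIdeal K 5 103 169
  let R := Localization.AtPrime Q
  let ι := algebraMap (MvPolynomial (Fin 3) K) R
  have hu : ∀ i, IsUnit (ι (X i)) := fun i => by
    refine (IsLocalization.AtPrime.isUnit_to_map_iff R Q _).2 ?_
    change X i ∉ pIdeal K 5 103 169
    rw [pIdeal, RingHom.mem_ker, toPoly, aeval_X]
    fin_cases i <;> simp
  choose u hu using hu
  let v : Rˣ := u 1 ^ 2 * u 2 * (u 0 ^ 75)⁻¹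
  let w : Rˣ := u 1 * u 2 ^ 3 * (u 0 ^ 122)⁻¹
  have mem_of : ∀ (a : Rˣ) (f g : MvPolynomial (Fin 3) K) (s : Rˣ), ι f = a * s → ι g = s →
      toPoly K 5 103 169 f = toPoly K 5 103 169 g → (a : R) - 1 ∈ Ideal.map ι Q := by
    intro a f g s hf hg hfg
    have hmem : f - g ∈ Q := by
      change f - g ∈ pIdeal K 5 103 169
      rw [pIdeal, RingHom.mem_ker, map_sub, hfg, sub_self]
    have : (a : R) - 1 = ι (f - g) * (s⁻¹ : Rˣ) := by
      rw [map_sub, hf, hg, sub_mul, mul_assoc, Units.mul_inv, mul_one]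
    rw [this]
    exact Ideal.mul_mem_right _ _ (Ideal.mem_map_of_mem ι hmem)
  have hv : (v : R) - 1 ∈ Ideal.map ι Q := by
    refine mem_of v (X 1 ^ 2 * X 2) (X 0 ^ 75) (u 0 ^ 75) ?_ ?_ ?_
    · rw [← Units.val_mul]
      simp [v, hu]
    · simp [hu]
    · simp only [toPoly, map_mul, map_pow, aeval_X, Matrix.cons_val]
      ring
  have hw : (w : R) - 1 ∈ Ideal.map ι Q := by
    refine mem_of w (X 1 * X 2 ^ 3) (X 0 ^ 122) (u 0 ^ 122) ?_ ?_ ?_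
    · rw [← Units.val_mul]
      simp [w, hu]
    · simp [hu]
    · simp only [toPoly, map_mul, map_pow, aeval_X, Matrix.cons_val]
      ring
  let U : Rˣ := u 0 ^ 1051 * (u 1 ^ 8)⁻¹ * (u 2 ^ 14)⁻¹
  have hmon : ∀ t, u 0 ^ expo t 0 * u 1 ^ expo t 1 * u 2 ^ expo t 2 =
      U * (v ^ vExp t * w ^ wExp t) := by
    intro t
    obtain ⟨h0, h1, h2⟩ := expo_spec t
    have e0 : u 0 ^ expo t 0 * (u 0 ^ 75) ^ vExp t * (u 0 ^ 122) ^ wExp t = u 0 ^ 1051 := by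
      rw [← pow_mul, ← pow_mul, ← pow_add, ← pow_add, h0]
    have e1 : u 1 ^ expo t 1 * u 1 ^ 8 = (u 1 ^ 2) ^ vExp t * u 1 ^ wExp t := by
      rw [← pow_mul, ← pow_add, ← pow_add, h1]
    have e2 : u 2 ^ expo t 2 * u 2 ^ 14 = u 2 ^ vExp t * (u 2 ^ 3) ^ wExp t := by
      rw [← pow_mul, ← pow_add, ← pow_add, h2]
    simp only [U, v, w, ← e0, mul_pow, inv_pow]
    rw [eq_mul_inv_of_mul_eq e1, eq_mul_inv_of_mul_eq e2]
    generalize u 0 ^ expo t 0 = a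
    generalize (u 0 ^ 75) ^ vExp t = b
    generalize (u 0 ^ 122) ^ wExp t = c
    generalize (u 1 ^ 8)⁻¹ = d
    generalize (u 2 ^ 14)⁻¹ = e
    generalize (u 1 ^ 2) ^ vExp t = f
    generalize u 1 ^ wExp t = g
    generalize u 2 ^ vExp t = i
    generalize (u 2 ^ 3) ^ wExp t = j
    calc a * (f * g * d) * (i * j * e) = a * (f * g * d) * (i * j * e) * (b * b⁻¹) * (c * c⁻¹) := by
          simp
      _ = _ := by ac_rfl
  have hι : ∀ t, ι (monomial (mexp t) (crv t : K)) =
      (U : R) * ((crv t : R) * ((v : R) ^ vExp t * (w : R) ^ wExp t)) := by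
    intro t
    have h := congrArg (Units.val) (hmon t)
    simp only [Units.val_mul, Units.val_pow_eq_pow_val, hu] at h
    rw [monomial_eq, Finsupp.prod_fintype _ _ (by simp), Fin.prod_univ_three, map_mul,
      map_intCast, map_intCast, map_mul, map_mul, map_pow, map_pow, map_pow]
    simp only [mexp_apply]
    rw [h]
    ring
  rw [symbPow, Ideal.mem_comap, Ideal.map_pow, curve, map_sum]
  change ∑ t, ι (monomial (mexp t) (crv t : K)) ∈ _
  simp only [hι]
  rw [← Finset.mul_sum]
  exact Ideal.mul_mem_left _ _ (sum_mul_pow_mul_pow_mem _ hv hw _ _ _ _ fun p q hpq =>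
    crv_vanish p (by lia) q (by lia) hpq)

theorem mem_support_curve_iff [CharZero K] {m : Fin 3 →₀ ℕ} :
    m ∈ (curve K).support ↔ ∃ t, mexp t = m := by
  constructor
  · intro hm
    exact exists_mexp_eq (sum_monomial_mexp_mem _ (mem_support_iff.1 hm))
  · rintro ⟨t, rfl⟩
    rw [mem_support_iff, curve, coeff_sum_monomial_mexp, Int.cast_ne_zero]
    exact (by decide : ∀ t, crv t ≠ 0) t

theorem expo_weight_le : ∀ t, expo t 1 * 11 + expo t 2 * 18 ≤ 220 := by decide +kernel

theorem irreducible_curve [CharZero K] : Irreducible (curve K) := by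
  classical
  have hD : ∀ m ∈ (curve K).support, Finsupp.weight (wt 5 103 169) m ≤ 2065 := by
    intro m hm
    obtain ⟨t, rfl⟩ := mem_support_curve_iff.1 hm
    exact (weight_mexp t).le
  have hE : ∀ m ∈ (curve K).support, Finsupp.weight ![0, 11, 18] m ≤ 220 := by
    intro m hm
    obtain ⟨t, rfl⟩ := mem_support_curve_iff.1 hm
    rw [weight_fin_three]
    simpa [mexp_apply] using expo_weight_le t
  refine ⟨fun hunit => ?_, fun g h hgh => ?_⟩
  · obtain ⟨c, -, hc⟩ := isUnit_iff_eq_C_of_isReduced.1 hunit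
    have h1 := mem_support_curve_iff (K := K).2 ⟨0, rfl⟩
    rw [hc, mem_support_iff, coeff_C, ite_ne_right_iff] at h1
    exact absurd (DFunLike.congr_fun h1.1 0) (by decide +kernel)
  · have hsplit : ∀ t, ∃ a ∈ g.support, ∃ b ∈ h.support, a + b = mexp t := by
      intro t
      have ht := mem_support_curve_iff (K := K).2 ⟨t, rfl⟩
      rw [hgh] at ht
      simpa [Finset.mem_add] using support_mul g h ht
    rw [hgh] at hD hE
    obtain ⟨a₁, ha₁, b₁, hb₁, h₁⟩ := hsplit 0
    obtain ⟨a₂, ha₂, b₂, hb₂, h₂⟩ := hsplit 4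
    obtain ⟨a₃, ha₃, b₃, hb₃, h₃⟩ := hsplit 28
    have e : ∀ {t a b}, a + b = mexp t → ∀ i, a i + b i = expo t i :=
      fun hab i => DFunLike.congr_fun hab i
    have x₁ : expo 0 0 = 413 ∧ expo 0 1 = 0 ∧ expo 0 2 = 0 := by decide +kernel
    have x₂ : expo 4 0 = 1 ∧ expo 4 1 = 20 ∧ expo 4 2 = 0 := by decide +kernel
    have x₃ : expo 28 0 = 0 ∧ expo 28 1 = 2 ∧ expo 28 2 = 11 := by decide +kernel
    have p₁ := e h₁ 0; have p₂ := e h₁ 1; have p₃ := e h₁ 2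
    have q₁ := e h₂ 0; have q₂ := e h₂ 1; have q₃ := e h₂ 2
    have r₁ := e h₃ 0; have r₂ := e h₃ 1; have r₃ := e h₃ 2
    have d₁₂ := weight_add_weight_le _ hD ha₁ hb₂
    have d₂₁ := weight_add_weight_le _ hD ha₂ hb₁
    have d₁₃ := weight_add_weight_le _ hD ha₁ hb₃
    have d₃₁ := weight_add_weight_le _ hD ha₃ hb₁
    have f₂₃ := weight_add_weight_le _ hE ha₂ hb₃
    have f₃₂ := weight_add_weight_le _ hE ha₃ hb₂
    simp only [weight_fin_three, wt, Matrix.cons_val] at d₁₂ d₂₁ d₁₃ d₃₁ f₂₃ f₃₂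
    have hg0 : g ≠ 0 := by rintro rfl; simp at ha₁
    have hh0 : h ≠ 0 := by rintro rfl; simp at hb₁
    have hpos : ∀ i, wt 5 103 169 i ≠ 0 := by decide
    have hor : (b₃ 0 = 0 ∧ b₃ 1 = 2 ∧ b₃ 2 = 11) ∨ (a₃ 0 = 0 ∧ a₃ 1 = 2 ∧ a₃ 2 = 11) := by
      lia
    rcases hor with hb | ha
    · refine Or.inl (isUnit_of_weight_support_eq_zero hpos hg0 fun m hm => ?_)
      have := weight_add_weight_le _ hD hm hb₃
      rw [weight_fin_three _ b₃, hb.1, hb.2.1, hb.2.2] at this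
      simp only [wt, Matrix.cons_val] at this ⊢
      lia
    · refine Or.inr (isUnit_of_weight_support_eq_zero hpos hh0 fun m hm => ?_)
      have := weight_add_weight_le _ hD ha₃ hm
      rw [weight_fin_three _ a₃, ha.1, ha.2.1, ha.2.2] at this
      simp only [wt, Matrix.cons_val] at this ⊢
      lia

theorem gpiece_eq_span_curve [CharZero K] :
    gpiece K 5 103 169 (symbPow (pIdeal K 5 103 169) 7) 2065 = Submodule.span K {curve K} := by
  have hmem : curve K ∈ gpiece K 5 103 169 (symbPow (pIdeal K 5 103 169) 7) 2065 :=
    ⟨curve_mem_symbPow, sum_monomial_mexp_mem _⟩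
  refine le_antisymm (fun f hf => ?_) ((Submodule.span_singleton_le_iff_mem _ _).2 hmem)
  let a := coeff (mexp (Fin.last 28)) f
  have hd := sub_mem hf (Submodule.smul_mem _ a hmem)
  have hsum := eq_sum_monomial_mexp hd.2
  have hlast : coeff (mexp (Fin.last 28)) (f - a • curve K) = 0 := by
    rw [coeff_sub, coeff_smul, curve, coeff_sum_monomial_mexp,
      show crv (Fin.last 28) = 1 from rfl, Int.cast_one, smul_eq_mul, mul_one, sub_self]
  have hz := eq_zero_of_coeff_last_eq_zero (hsum ▸ hd.1) hlast
  refine Submodule.mem_span_singleton.2 ⟨a, (sub_eq_zero.1 ?_).symm⟩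
  rw [hsum]
  exact Finset.sum_eq_zero fun t _ => by rw [congrFun hz t, Pi.zero_apply, map_zero]

end Field

end NegativeCurve

/-- for char-`0` `K`, the space `[𝔭_K(5,103,169)^{(7)}]_{2065}` is
one-dimensional, spanned by an irreducible polynomial `f` whose coefficient of
`x^{413}` is nonzero; this `f` is a negative curve (`2065² < 5·103·169·7²`). -/
theorem statement4 (K : Type*) [Field K] [CharZero K] :
    ∃ f : MvPolynomial (Fin 3) K,
      Irreducible f ∧
      MvPolynomial.coeff (Finsupp.single (0 : Fin 3) 413) f ≠ 0 ∧
      gpiece K 5 103 169 (symbPow (pIdeal K 5 103 169) 7) 2065 =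
        Submodule.span K {f} ∧
      2065 ^ 2 < 5 * 103 * 169 * 7 ^ 2 := by
  refine ⟨NegativeCurve.curve K, NegativeCurve.irreducible_curve, ?_,
    NegativeCurve.gpiece_eq_span_curve, by norm_num⟩
  have h : Finsupp.single (0 : Fin 3) 413 = NegativeCurve.mexp 0 := by
    ext i
    fin_cases i <;> simp [NegativeCurve.mexp_apply, NegativeCurve.expo, NegativeCurve.vExp,
      NegativeCurve.wExp]
  rw [h, NegativeCurve.curve, NegativeCurve.coeff_sum_monomial_mexp, Int.cast_ne_zero]
  decide
end
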